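/- Pressure-robust and μ-robust second-order velocity superconvergence of the RMAC scheme on non-uniform grids: let (u,p) be a smooth solution of the Stokes problem with source g, with u ∈ W^{2,∞}([0,T];W^{4,∞}(Ω))². Then, for Δt sufficiently small, the RMAC solution satisfies ‖W^m − u^m‖_{l2} ≤ C(h²+k²+Δt) for every 1 ≤ m ≤ N, where u^m denotes pointwise evaluation of the exact velocity at the grid points (u^x at (x_i,y_{j+1/2},t^m), u^y at (x_{i+1/2},y_j,t^m)), and the constant C depends only on T, Ω, the mesh-regularity constant C₀, ‖u‖_{W^{2,∞}([0,T];W^{4,∞}(Ω))}, and on μ only through the factor e^{μT/2}(1+μ+μ²+μ³)^{1/2}; in particular C is independent of h, k, Δt and of the pressure p, and remains bounded as μ→0. -/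

import Mathlib

open Finset MeasureTheory Real

noncomputable section

namespace RMAC

/-! ### Continuous-level notions -/

/-- Partial derivative in the first (x) variable of a function of (x, y, t). -/
def pdx (f : ℝ → ℝ → ℝ → ℝ) : ℝ → ℝ → ℝ → ℝ := fun x y t => deriv (fun s => f s y t) x

/-- Partial derivative in the second (y) variable. -/
def pdy (f : ℝ → ℝ → ℝ → ℝ) : ℝ → ℝ → ℝ → ℝ := fun x y t => deriv (fun s => f x s t) y

/-- Partial derivative in the third (t) variable. -/
def pdt (f : ℝ → ℝ → ℝ → ℝ) : ℝ → ℝ → ℝ → ℝ := fun x y t => deriv (fun s => f x y s) t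

/-- Infinitely differentiable function of (x, y, t). -/
def Smooth (f : ℝ → ℝ → ℝ → ℝ) : Prop :=
  ∀ n : ℕ, ContDiff ℝ n (fun q : ℝ × ℝ × ℝ => f q.1 q.2.1 q.2.2)

/-- `SobBound a b f Lx Ly T M` : all derivatives `∂_t^{a'} ∂_x^{b'} ∂_y^{c'} f` with `a' ≤ a`,
`b' + c' ≤ b` are bounded by `M` on `[0,Lx] × [0,Ly] × [0,T]`; this encodes
`‖f‖_{W^{a,∞}([0,T];W^{b,∞}(Ω))} ≤ M`. -/
def SobBound (a b : ℕ) (f : ℝ → ℝ → ℝ → ℝ) (Lx Ly T M : ℝ) : Prop :=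
  ∀ a' b' c' : ℕ, a' ≤ a → b' + c' ≤ b →
    ∀ x y t : ℝ, x ∈ Set.Icc 0 Lx → y ∈ Set.Icc 0 Ly → t ∈ Set.Icc 0 T →
      |(pdt^[a'] (pdx^[b'] (pdy^[c'] f))) x y t| ≤ M

/-- The time-dependent Stokes problem on `Ω = (0,Lx) × (0,Ly)`, `t ∈ (0,T]`, with
viscosity `μ`, source `(gx, gy)`, homogeneous Dirichlet boundary condition and
homogeneous initial condition. -/
def IsStokesSol (μ Lx Ly T : ℝ) (ux uy p gx gy : ℝ → ℝ → ℝ → ℝ) : Prop :=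
  (∀ x y t : ℝ, x ∈ Set.Ioo 0 Lx → y ∈ Set.Ioo 0 Ly → t ∈ Set.Ioc 0 T →
      pdt ux x y t - μ * (pdx (pdx ux) x y t + pdy (pdy ux) x y t) + pdx p x y t = gx x y t ∧
      pdt uy x y t - μ * (pdx (pdx uy) x y t + pdy (pdy uy) x y t) + pdy p x y t = gy x y t ∧
      pdx ux x y t + pdy uy x y t = 0) ∧
  (∀ x y t : ℝ, x ∈ Set.Icc 0 Lx → y ∈ Set.Icc 0 Ly → t ∈ Set.Ioc 0 T →
      (x = 0 ∨ x = Lx ∨ y = 0 ∨ y = Ly) → ux x y t = 0 ∧ uy x y t = 0) ∧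
  (∀ x y : ℝ, x ∈ Set.Icc 0 Lx → y ∈ Set.Icc 0 Ly → ux x y 0 = 0 ∧ uy x y 0 = 0)

/-- Divergence-free velocity field on `Ω` for all times in `[0,T]`. -/
def DivFree (Lx Ly T : ℝ) (ux uy : ℝ → ℝ → ℝ → ℝ) : Prop :=
  ∀ x y t : ℝ, x ∈ Set.Ioo 0 Lx → y ∈ Set.Ioo 0 Ly → t ∈ Set.Icc 0 T →
    pdx ux x y t + pdy uy x y t = 0

/-- Homogeneous velocity boundary values on `∂Ω` for all times in `[0,T]`. -/
def BoundaryZero (Lx Ly T : ℝ) (ux uy : ℝ → ℝ → ℝ → ℝ) : Prop :=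
  ∀ x y t : ℝ, x ∈ Set.Icc 0 Lx → y ∈ Set.Icc 0 Ly → t ∈ Set.Icc 0 T →
    (x = 0 ∨ x = Lx ∨ y = 0 ∨ y = Ly) → ux x y t = 0 ∧ uy x y t = 0

/-! ### The staggered (MAC) grid

Index conventions for grid functions `f : ℤ → ℤ → ℝ`:
* cell-centered functions: `f i j` is the value at `(x_{i+1/2}, y_{j+1/2})`;
* x-edge functions (like `u^x`): `f i j` is the value at `(x_i, y_{j+1/2})`,
  with `j = -1` and `j = Ny` the ghost values representing `(x_i, y_0)` and `(x_i, y_{Ny})`;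
* y-edge functions (like `u^y`): `f i j` is the value at `(x_{i+1/2}, y_j)`,
  with `i = -1` and `i = Nx` the ghost values representing `(x_0, y_j)` and `(x_{Nx}, y_j)`;
* node functions: `f i j` is the value at `(x_i, y_j)`. -/
structure Grid where
  Nx : ℕ
  Ny : ℕ
  Lx : ℝ
  Ly : ℝ
  xp : ℤ → ℝ
  yp : ℤ → ℝ
  one_le_Nx : 1 ≤ Nx
  one_le_Ny : 1 ≤ Ny
  xp_zero : xp 0 = 0
  xp_last : xp Nx = Lx
  yp_zero : yp 0 = 0
  yp_last : yp Ny = Ly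
  xp_mono : ∀ i : ℤ, 0 ≤ i → i < Nx → xp i < xp (i + 1)
  yp_mono : ∀ j : ℤ, 0 ≤ j → j < Ny → yp j < yp (j + 1)

namespace Grid

variable (G : Grid)

/-- `h_{i+1/2} = x_{i+1} - x_i`. -/
def hh (i : ℤ) : ℝ := G.xp (i + 1) - G.xp i

/-- `k_{j+1/2} = y_{j+1} - y_j`. -/
def kk (j : ℤ) : ℝ := G.yp (j + 1) - G.yp j

/-- `x_{i+1/2} = (x_i + x_{i+1})/2`. -/
def xh (i : ℤ) : ℝ := (G.xp i + G.xp (i + 1)) / 2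

/-- `y_{j+1/2} = (y_j + y_{j+1})/2`. -/
def yh (j : ℤ) : ℝ := (G.yp j + G.yp (j + 1)) / 2

/-- `h_i = (h_{i-1/2} + h_{i+1/2})/2`, with `h_0 = h_{1/2}/2`, `h_{Nx} = h_{Nx-1/2}/2`. -/
def hc (i : ℤ) : ℝ :=
  if i = 0 then G.hh 0 / 2
  else if i = (G.Nx : ℤ) then G.hh ((G.Nx : ℤ) - 1) / 2
  else (G.hh (i - 1) + G.hh i) / 2

/-- `k_j = (k_{j-1/2} + k_{j+1/2})/2`, with `k_0 = k_{1/2}/2`, `k_{Ny} = k_{Ny-1/2}/2`. -/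
def kc (j : ℤ) : ℝ :=
  if j = 0 then G.kk 0 / 2
  else if j = (G.Ny : ℤ) then G.kk ((G.Ny : ℤ) - 1) / 2
  else (G.kk (j - 1) + G.kk j) / 2

/-- `h = max_i h_{i+1/2}`. -/
def hmax : ℝ :=
  (Finset.Icc (0 : ℤ) ((G.Nx : ℤ) - 1)).sup'
    (Finset.nonempty_Icc.mpr (by have := G.one_le_Nx; omega)) G.hh

/-- `k = max_j k_{j+1/2}`. -/
def kmax : ℝ :=
  (Finset.Icc (0 : ℤ) ((G.Ny : ℤ) - 1)).sup'
    (Finset.nonempty_Icc.mpr (by have := G.one_le_Ny; omega)) G.kk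

/-- Mesh regularity: `min_{i,j} {h_{i+1/2}, k_{j+1/2}} ≥ C₀ · max_{i,j} {h_{i+1/2}, k_{j+1/2}}`. -/
def Regular (C₀ : ℝ) : Prop :=
  (∀ i : ℤ, 0 ≤ i → i < G.Nx → C₀ * G.hmax ≤ G.hh i ∧ C₀ * G.kmax ≤ G.hh i) ∧
  (∀ j : ℤ, 0 ≤ j → j < G.Ny → C₀ * G.hmax ≤ G.kk j ∧ C₀ * G.kmax ≤ G.kk j)

/-! ### Difference operators -/

/-- `d_x` of an x-edge function: value at the cell center `(x_{i+1/2}, y_{j+1/2})`. -/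
def dxEx (f : ℤ → ℤ → ℝ) (i j : ℤ) : ℝ := (f (i + 1) j - f i j) / G.hh i

/-- `D_y` of an x-edge function: value at the node `(x_i, y_j)`. -/
def DyEx (f : ℤ → ℤ → ℝ) (i j : ℤ) : ℝ := (f i j - f i (j - 1)) / G.kc j

/-- `d_y` of a y-edge function: value at the cell center `(x_{i+1/2}, y_{j+1/2})`. -/
def dyEy (f : ℤ → ℤ → ℝ) (i j : ℤ) : ℝ := (f i (j + 1) - f i j) / G.kk j

/-- `D_x` of a y-edge function: value at the node `(x_i, y_j)`. -/
def DxEy (f : ℤ → ℤ → ℝ) (i j : ℤ) : ℝ := (f i j - f (i - 1) j) / G.hc i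

/-- `D_x` of a cell-centered function: value at the x-edge point `(x_i, y_{j+1/2})`. -/
def DxC (q : ℤ → ℤ → ℝ) (i j : ℤ) : ℝ := (q i j - q (i - 1) j) / G.hc i

/-- `D_y` of a cell-centered function: value at the y-edge point `(x_{i+1/2}, y_j)`. -/
def DyC (q : ℤ → ℤ → ℝ) (i j : ℤ) : ℝ := (q i j - q i (j - 1)) / G.kc j

/-! ### Discrete inner products and norms -/

/-- `(f,g)_{l²,M}` over cell centers. -/
def ipM (f g : ℤ → ℤ → ℝ) : ℝ :=
  ∑ i ∈ Finset.Icc (0 : ℤ) ((G.Nx : ℤ) - 1), ∑ j ∈ Finset.Icc (0 : ℤ) ((G.Ny : ℤ) - 1),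
    G.hh i * G.kk j * f i j * g i j

/-- `(f,g)_{l²,T,M}` over x-edge points. -/
def ipTM (f g : ℤ → ℤ → ℝ) : ℝ :=
  ∑ i ∈ Finset.Icc (1 : ℤ) ((G.Nx : ℤ) - 1), ∑ j ∈ Finset.Icc (0 : ℤ) ((G.Ny : ℤ) - 1),
    G.hc i * G.kk j * f i j * g i j

/-- `(f,g)_{l²,M,T}` over y-edge points. -/
def ipMT (f g : ℤ → ℤ → ℝ) : ℝ :=
  ∑ i ∈ Finset.Icc (0 : ℤ) ((G.Nx : ℤ) - 1), ∑ j ∈ Finset.Icc (1 : ℤ) ((G.Ny : ℤ) - 1),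
    G.hh i * G.kc j * f i j * g i j

/-- `(f,g)_{l²,T_x}`. -/
def ipTx (f g : ℤ → ℤ → ℝ) : ℝ :=
  ∑ i ∈ Finset.Icc (0 : ℤ) (G.Nx : ℤ), ∑ j ∈ Finset.Icc (1 : ℤ) ((G.Ny : ℤ) - 1),
    G.hc i * G.kc j * f i j * g i j

/-- `(f,g)_{l²,T_y}`. -/
def ipTy (f g : ℤ → ℤ → ℝ) : ℝ :=
  ∑ i ∈ Finset.Icc (1 : ℤ) ((G.Nx : ℤ) - 1), ∑ j ∈ Finset.Icc (0 : ℤ) (G.Ny : ℤ),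
    G.hc i * G.kc j * f i j * g i j

/-- `‖v‖²_{l²} = ‖v^x‖²_{l²,T,M} + ‖v^y‖²_{l²,M,T}` for a discrete velocity. -/
def velNormSq (vx vy : ℤ → ℤ → ℝ) : ℝ := G.ipTM vx vx + G.ipMT vy vy

/-- `‖Dv‖²_{l²}` for a discrete velocity. -/
def DvelNormSq (vx vy : ℤ → ℤ → ℝ) : ℝ :=
  G.ipM (G.dxEx vx) (G.dxEx vx) + G.ipTy (G.DyEx vx) (G.DyEx vx) +
    G.ipTx (G.DxEy vy) (G.DxEy vy) + G.ipM (G.dyEy vy) (G.dyEy vy)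

/-! ### Right-hand side discretization and the RMAC scheme -/

/-- `f^{x,n}_{i,j+1/2} = (1/h_i) ∫_{x_{i-1/2}}^{x_{i+1/2}} g^x(x, y_{j+1/2}, t^n) dx`. -/
def avgFx (gx : ℝ → ℝ → ℝ → ℝ) (Δt : ℝ) : ℕ → ℤ → ℤ → ℝ := fun n i j =>
  (1 / G.hc i) * ∫ x in (G.xh (i - 1))..(G.xh i), gx x (G.yh j) ((n : ℝ) * Δt)

/-- `f^{y,n}_{i+1/2,j} = (1/k_j) ∫_{y_{j-1/2}}^{y_{j+1/2}} g^y(x_{i+1/2}, y, t^n) dy`. -/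
def avgFy (gy : ℝ → ℝ → ℝ → ℝ) (Δt : ℝ) : ℕ → ℤ → ℤ → ℝ := fun n i j =>
  (1 / G.kc j) * ∫ y in (G.yh (j - 1))..(G.yh j), gy (G.xh i) y ((n : ℝ) * Δt)

/-- The RMAC scheme for the time-dependent Stokes equations, with discrete right-hand
sides `fx`, `fy`: homogeneous discrete boundary and initial conditions, the two discrete
momentum equations and the discrete divergence-free constraint. -/
def IsRMAC (μ Δt : ℝ) (fx fy Wx Wy Z : ℕ → ℤ → ℤ → ℝ) : Prop :=
  (∀ n : ℕ, ∀ j : ℤ, Wx n 0 j = 0 ∧ Wx n (G.Nx : ℤ) j = 0) ∧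
  (∀ n : ℕ, ∀ i : ℤ, Wx n i (-1) = 0 ∧ Wx n i (G.Ny : ℤ) = 0) ∧
  (∀ n : ℕ, ∀ i : ℤ, Wy n i 0 = 0 ∧ Wy n i (G.Ny : ℤ) = 0) ∧
  (∀ n : ℕ, ∀ j : ℤ, Wy n (-1) j = 0 ∧ Wy n (G.Nx : ℤ) j = 0) ∧
  (∀ i j : ℤ, Wx 0 i j = 0 ∧ Wy 0 i j = 0) ∧
  (∀ n : ℕ, 1 ≤ n →
    ∀ i ∈ Finset.Icc (1 : ℤ) ((G.Nx : ℤ) - 1), ∀ j ∈ Finset.Icc (0 : ℤ) ((G.Ny : ℤ) - 1),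
      (Wx n i j - Wx (n - 1) i j) / Δt
        - μ * ((G.dxEx (Wx n) i j - G.dxEx (Wx n) (i - 1) j) / G.hc i)
        - μ * ((G.DyEx (Wx n) i (j + 1) - G.DyEx (Wx n) i j) / G.kk j)
        + G.DxC (Z n) i j = fx n i j) ∧
  (∀ n : ℕ, 1 ≤ n →
    ∀ i ∈ Finset.Icc (0 : ℤ) ((G.Nx : ℤ) - 1), ∀ j ∈ Finset.Icc (1 : ℤ) ((G.Ny : ℤ) - 1),
      (Wy n i j - Wy (n - 1) i j) / Δt
        - μ * ((G.DxEy (Wy n) (i + 1) j - G.DxEy (Wy n) i j) / G.hh i)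
        - μ * ((G.dyEy (Wy n) i j - G.dyEy (Wy n) i (j - 1)) / G.kc j)
        + G.DyC (Z n) i j = fy n i j) ∧
  (∀ n : ℕ, 1 ≤ n →
    ∀ i ∈ Finset.Icc (0 : ℤ) ((G.Nx : ℤ) - 1), ∀ j ∈ Finset.Icc (0 : ℤ) ((G.Ny : ℤ) - 1),
      G.dxEx (Wx n) i j + G.dyEy (Wy n) i j = 0)

/-- The compact-support condition: the discrete solution vanishes within one mesh
layer of `∂Ω`. -/
def CompactSupp (Wx Wy Z : ℕ → ℤ → ℤ → ℝ) : Prop :=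
  (∀ n : ℕ, ∀ j : ℤ,
    Wx n 0 j = 0 ∧ Wx n 1 j = 0 ∧ Wx n ((G.Nx : ℤ) - 1) j = 0 ∧ Wx n (G.Nx : ℤ) j = 0) ∧
  (∀ n : ℕ, ∀ i : ℤ,
    Wx n i (-1) = 0 ∧ Wx n i 0 = 0 ∧ Wx n i ((G.Ny : ℤ) - 1) = 0 ∧ Wx n i (G.Ny : ℤ) = 0) ∧
  (∀ n : ℕ, ∀ j : ℤ,
    Wy n (-1) j = 0 ∧ Wy n 0 j = 0 ∧ Wy n ((G.Nx : ℤ) - 1) j = 0 ∧ Wy n (G.Nx : ℤ) j = 0) ∧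
  (∀ n : ℕ, ∀ i : ℤ,
    Wy n i 0 = 0 ∧ Wy n i 1 = 0 ∧ Wy n i ((G.Ny : ℤ) - 1) = 0 ∧ Wy n i (G.Ny : ℤ) = 0) ∧
  (∀ n : ℕ, ∀ j : ℤ, Z n 0 j = 0) ∧
  (∀ n : ℕ, ∀ i : ℤ, Z n i 0 = 0)

/-! ### Auxiliary interpolants and consistency functions -/

/-- The auxiliary interpolant `ũ^{x,n}_{i,j+1/2}`, with its boundary extension. -/
def tux (ux : ℝ → ℝ → ℝ → ℝ) (Δt : ℝ) (n : ℕ) (i j : ℤ) : ℝ :=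
  if j = -1 then ux (G.xp i) (G.yp 0) ((n : ℝ) * Δt)
  else if j = (G.Ny : ℤ) then ux (G.xp i) (G.yp (G.Ny : ℤ)) ((n : ℝ) * Δt)
  else (1 / G.kk j) * (∫ y in (G.yp j)..(G.yp (j + 1)), ux (G.xp i) y ((n : ℝ) * Δt))
    - (G.kk j) ^ 2 / 6 * pdy (pdy ux) (G.xp i) (G.yh j) ((n : ℝ) * Δt)

/-- The auxiliary interpolant `ũ^{y,n}_{i+1/2,j}`, with its boundary extension. -/
def tuy (uy : ℝ → ℝ → ℝ → ℝ) (Δt : ℝ) (n : ℕ) (i j : ℤ) : ℝ :=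
  if i = -1 then uy (G.xp 0) (G.yp j) ((n : ℝ) * Δt)
  else if i = (G.Nx : ℤ) then uy (G.xp (G.Nx : ℤ)) (G.yp j) ((n : ℝ) * Δt)
  else (1 / G.hh i) * (∫ x in (G.xp i)..(G.xp (i + 1)), uy x (G.yp j) ((n : ℝ) * Δt))
    - (G.hh i) ^ 2 / 6 * pdx (pdx uy) (G.xh i) (G.yp j) ((n : ℝ) * Δt)

/-- `γ^{x,n}_{i+1/2,j+1/2} = (h_{i+1/2}²/8) ∂²u^x/∂t∂x (x_{i+1/2}, y_{j+1/2}, t^n)`. -/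
def gammax (ux : ℝ → ℝ → ℝ → ℝ) (Δt : ℝ) (n : ℕ) (i j : ℤ) : ℝ :=
  (G.hh i) ^ 2 / 8 * pdt (pdx ux) (G.xh i) (G.yh j) ((n : ℝ) * Δt)

/-- `γ^{y,n}_{i+1/2,j+1/2} = (k_{j+1/2}²/8) ∂²u^y/∂t∂y (x_{i+1/2}, y_{j+1/2}, t^n)`. -/
def gammay (uy : ℝ → ℝ → ℝ → ℝ) (Δt : ℝ) (n : ℕ) (i j : ℤ) : ℝ :=
  (G.kk j) ^ 2 / 8 * pdt (pdy uy) (G.xh i) (G.yh j) ((n : ℝ) * Δt)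

end Grid

/-! ### Averaging (interpolation) operators on a uniform grid -/

/-- `P^x_h` : x-edge function → cell-centered function. -/
def PxEx (f : ℤ → ℤ → ℝ) (i j : ℤ) : ℝ := (f i j + f (i + 1) j) / 2

/-- `P^x_h` : cell-centered function → x-edge function. -/
def PxC (q : ℤ → ℤ → ℝ) (i j : ℤ) : ℝ := (q (i - 1) j + q i j) / 2

/-- `P^x_h` : y-edge function → node function. -/
def PxEyN (f : ℤ → ℤ → ℝ) (i j : ℤ) : ℝ := (f (i - 1) j + f i j) / 2

/-- `P^x_h` : node function → y-edge function. -/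
def PxN (g : ℤ → ℤ → ℝ) (i j : ℤ) : ℝ := (g i j + g (i + 1) j) / 2

/-- `P^y_h` : y-edge function → cell-centered function. -/
def PyEy (f : ℤ → ℤ → ℝ) (i j : ℤ) : ℝ := (f i j + f i (j + 1)) / 2

/-- `P^y_h` : cell-centered function → y-edge function. -/
def PyC (q : ℤ → ℤ → ℝ) (i j : ℤ) : ℝ := (q i (j - 1) + q i j) / 2

/-- `P^y_h` : x-edge function → node function. -/
def PyEx (f : ℤ → ℤ → ℝ) (i j : ℤ) : ℝ := (f i (j - 1) + f i j) / 2

/-- `P^y_h` : node function → x-edge function. -/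
def PyN (g : ℤ → ℤ → ℝ) (i j : ℤ) : ℝ := (g i j + g i (j + 1)) / 2

namespace Grid

variable (G : Grid)

/-- The discrete nonlinear term `α^{x,n}_{i,j+1/2}` of the fully implicit RMAC scheme. -/
def alphaX (Wx Wy : ℤ → ℤ → ℝ) (i j : ℤ) : ℝ :=
  (Wx i j * G.DxC (PxEx Wx) i j
    + PxC (G.dxEx fun a b => (Wx a b) ^ 2) i j
    + PyN (fun a b => PxEyN Wy a b * G.DyEx Wx a b) i j
    + (PyEx Wx i (j + 1) * PxEyN Wy i (j + 1) - PyEx Wx i j * PxEyN Wy i j) / G.kk j) / 2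

/-- The discrete nonlinear term `α^{y,n}_{i+1/2,j}` of the fully implicit RMAC scheme. -/
def alphaY (Wx Wy : ℤ → ℤ → ℝ) (i j : ℤ) : ℝ :=
  (Wy i j * G.DyC (PyEy Wy) i j
    + PyC (G.dyEy fun a b => (Wy a b) ^ 2) i j
    + PxN (fun a b => PyEx Wx a b * G.DxEy Wy a b) i j
    + (PyEx Wx (i + 1) j * PxEyN Wy (i + 1) j - PyEx Wx i j * PxEyN Wy i j) / G.hh i) / 2

/-- The fully implicit RMAC scheme for the Navier–Stokes equations. -/
def IsRMACNS (μ Δt : ℝ) (fx fy Wx Wy Z : ℕ → ℤ → ℤ → ℝ) : Prop :=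
  (∀ n : ℕ, ∀ j : ℤ, Wx n 0 j = 0 ∧ Wx n (G.Nx : ℤ) j = 0) ∧
  (∀ n : ℕ, ∀ i : ℤ, Wx n i (-1) = 0 ∧ Wx n i (G.Ny : ℤ) = 0) ∧
  (∀ n : ℕ, ∀ i : ℤ, Wy n i 0 = 0 ∧ Wy n i (G.Ny : ℤ) = 0) ∧
  (∀ n : ℕ, ∀ j : ℤ, Wy n (-1) j = 0 ∧ Wy n (G.Nx : ℤ) j = 0) ∧
  (∀ i j : ℤ, Wx 0 i j = 0 ∧ Wy 0 i j = 0) ∧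
  (∀ n : ℕ, 1 ≤ n →
    ∀ i ∈ Finset.Icc (1 : ℤ) ((G.Nx : ℤ) - 1), ∀ j ∈ Finset.Icc (0 : ℤ) ((G.Ny : ℤ) - 1),
      (Wx n i j - Wx (n - 1) i j) / Δt
        - μ * ((G.dxEx (Wx n) i j - G.dxEx (Wx n) (i - 1) j) / G.hc i)
        - μ * ((G.DyEx (Wx n) i (j + 1) - G.DyEx (Wx n) i j) / G.kk j)
        + G.alphaX (Wx n) (Wy n) i j
        + G.DxC (Z n) i j = fx n i j) ∧
  (∀ n : ℕ, 1 ≤ n →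
    ∀ i ∈ Finset.Icc (0 : ℤ) ((G.Nx : ℤ) - 1), ∀ j ∈ Finset.Icc (1 : ℤ) ((G.Ny : ℤ) - 1),
      (Wy n i j - Wy (n - 1) i j) / Δt
        - μ * ((G.DxEy (Wy n) (i + 1) j - G.DxEy (Wy n) i j) / G.hh i)
        - μ * ((G.dyEy (Wy n) i j - G.dyEy (Wy n) i (j - 1)) / G.kc j)
        + G.alphaY (Wx n) (Wy n) i j
        + G.DyC (Z n) i j = fy n i j) ∧
  (∀ n : ℕ, 1 ≤ n →
    ∀ i ∈ Finset.Icc (0 : ℤ) ((G.Nx : ℤ) - 1), ∀ j ∈ Finset.Icc (0 : ℤ) ((G.Ny : ℤ) - 1),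
      G.dxEx (Wx n) i j + G.dyEy (Wy n) i j = 0)

/-- A uniform grid with mesh sizes `h` (in x) and `k` (in y). -/
def Uniform (h k : ℝ) : Prop :=
  (∀ i : ℤ, 0 ≤ i → i < G.Nx → G.hh i = h) ∧ (∀ j : ℤ, 0 ≤ j → j < G.Ny → G.kk j = k)

end Grid

end RMAC

namespace RMAC

/-! ### One-dimensional Taylor estimates -/

/-- `F k` is the `k`-th derivative of `F 0`. -/
def DerivSeq (F : ℕ → ℝ → ℝ) : Prop := ∀ k x, HasDerivAt (F k) (F (k + 1) x) x

namespace DerivSeq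

variable {F : ℕ → ℝ → ℝ} {M : ℝ} {x y : ℝ}

lemma shift (hF : DerivSeq F) (m : ℕ) : DerivSeq fun k => F (k + m) := by
  intro k x
  have := hF (k + m) x
  rwa [show k + m + 1 = k + 1 + m by ring] at this

lemma continuous (hF : DerivSeq F) (k : ℕ) : Continuous (F k) :=
  continuous_iff_continuousAt.mpr fun x => (hF k x).continuousAt

lemma sub (hF : DerivSeq F) {G : ℕ → ℝ → ℝ} (hG : DerivSeq G) :
    DerivSeq fun k x => F k x - G k x := fun k x => (hF k x).sub (hG k x)

lemma div_const (hF : DerivSeq F) (c : ℝ) : DerivSeq fun k x => F k x / c :=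
  fun k x => (hF k x).div_const c

/-- The sequence obtained by prepending the primitive of `F 0` vanishing at `a`. -/
def prim (F : ℕ → ℝ → ℝ) (a : ℝ) : ℕ → ℝ → ℝ
  | 0 => fun x => ∫ s in a..x, F 0 s
  | k + 1 => F k

lemma prim_derivSeq (hF : DerivSeq F) (a : ℝ) : DerivSeq (prim F a) := by
  intro k x
  cases k with
  | zero =>
    exact intervalIntegral.integral_hasDerivAt_right
      ((hF.continuous 0).intervalIntegrable _ _)
      ((hF.continuous 0).stronglyMeasurableAtFilter _ _) (hF.continuous 0).continuousAt
  | succ k => exact hF k x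

lemma eq_zero_of_eq_zero (hF : DerivSeq F) {a b : ℝ} {k : ℕ}
    (h : ∀ z ∈ Set.Ioo a b, F k z = 0) : ∀ z ∈ Set.Ioo a b, F (k + 1) z = 0 := by
  intro z hz
  have h0 : F k =ᶠ[nhds z] fun _ => 0 := by
    filter_upwards [isOpen_Ioo.mem_nhds hz] with w hw using h w hw
  exact (hF k z).unique ((hasDerivAt_const z (0 : ℝ)).congr_of_eventuallyEq h0)

end DerivSeq

lemma abs_sub_le_of_deriv_le {g g' : ℝ → ℝ} {x y B : ℝ} (hg : ∀ z, HasDerivAt g (g' z) z)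
    (hB : ∀ z ∈ Set.uIcc x y, |g' z| ≤ B) : |g y - g x| ≤ B * |y - x| := by
  have := (convex_uIcc x y).norm_image_sub_le_of_norm_hasDerivWithin_le (f := g) (f' := g')
    (fun z _ => (hg z).hasDerivWithinAt) (fun z hz => by simpa using hB z hz)
    Set.left_mem_uIcc Set.right_mem_uIcc
  simpa using this

lemma abs_sub_le_of_mem_uIcc {x y z : ℝ} (hz : z ∈ Set.uIcc x y) : |z - x| ≤ |y - x| :=
  Set.abs_sub_left_of_mem_uIcc hz

lemma forall_uIcc_left {P : ℝ → Prop} {x y z : ℝ} (hz : z ∈ Set.uIcc x y)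
    (h : ∀ w ∈ Set.uIcc x y, P w) : ∀ w ∈ Set.uIcc x z, P w := fun w hw =>
  h w (Set.uIcc_subset_uIcc Set.left_mem_uIcc hz hw)

namespace DerivSeq

variable {F : ℕ → ℝ → ℝ} {M : ℝ} {x y : ℝ}

lemma nonneg_of_bound {k : ℕ} (h : ∀ z ∈ Set.uIcc x y, |F k z| ≤ M) : 0 ≤ M :=
  (abs_nonneg _).trans (h x Set.left_mem_uIcc)

lemma taylor_one (hF : DerivSeq F) (h : ∀ z ∈ Set.uIcc x y, |F 1 z| ≤ M) :
    |F 0 y - F 0 x| ≤ M * |y - x| :=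
  abs_sub_le_of_deriv_le (hF 0) h

lemma taylor_two (hF : DerivSeq F) (h : ∀ z ∈ Set.uIcc x y, |F 2 z| ≤ M) :
    |F 0 y - F 0 x - F 1 x * (y - x)| ≤ M * |y - x| ^ 2 := by
  have hM := nonneg_of_bound h
  have := abs_sub_le_of_deriv_le (g := fun z => F 0 z - F 1 x * (z - x))
    (g' := fun z => F 1 z - F 1 x) (x := x) (y := y) (B := M * |y - x|)
    (fun z => by
      simpa using (hF 0 z).fun_sub (((hasDerivAt_id' z).sub_const x).const_mul (F 1 x)))
    (fun z hz => ((hF.shift 1).taylor_one (forall_uIcc_left hz h)).trans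
      (by have := abs_sub_le_of_mem_uIcc hz; gcongr))
  calc _ = |F 0 y - F 1 x * (y - x) - (F 0 x - F 1 x * (x - x))| := by congr 1; ring
    _ ≤ M * |y - x| * |y - x| := this
    _ = _ := by ring

lemma taylor_three (hF : DerivSeq F) (h : ∀ z ∈ Set.uIcc x y, |F 3 z| ≤ M) :
    |F 0 y - F 0 x - F 1 x * (y - x) - F 2 x * (y - x) ^ 2 / 2| ≤ M * |y - x| ^ 3 := by
  have hM := nonneg_of_bound h
  have := abs_sub_le_of_deriv_le
    (g := fun z => F 0 z - F 1 x * (z - x) - F 2 x * (z - x) ^ 2 / 2)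
    (g' := fun z => F 1 z - F 1 x - F 2 x * (z - x)) (x := x) (y := y) (B := M * |y - x| ^ 2)
    (fun z => by
      have h1 := (hasDerivAt_id' z).sub_const x
      refine (((hF 0 z).fun_sub (h1.const_mul (F 1 x))).fun_sub
        (((h1.fun_pow 2).const_mul (F 2 x)).div_const 2)).congr_deriv ?_
      simp; ring)
    (fun z hz => ((hF.shift 1).taylor_two (forall_uIcc_left hz h)).trans
      (by have := abs_sub_le_of_mem_uIcc hz; gcongr))
  calc _ = |F 0 y - F 1 x * (y - x) - F 2 x * (y - x) ^ 2 / 2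
        - (F 0 x - F 1 x * (x - x) - F 2 x * (x - x) ^ 2 / 2)| := by congr 1; ring
    _ ≤ M * |y - x| ^ 2 * |y - x| := this
    _ = _ := by ring

lemma taylor_four (hF : DerivSeq F) (h : ∀ z ∈ Set.uIcc x y, |F 4 z| ≤ M) :
    |F 0 y - F 0 x - F 1 x * (y - x) - F 2 x * (y - x) ^ 2 / 2 - F 3 x * (y - x) ^ 3 / 6|
      ≤ M * |y - x| ^ 4 := by
  have hM := nonneg_of_bound h
  have := abs_sub_le_of_deriv_le
    (g := fun z => F 0 z - F 1 x * (z - x) - F 2 x * (z - x) ^ 2 / 2 - F 3 x * (z - x) ^ 3 / 6)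
    (g' := fun z => F 1 z - F 1 x - F 2 x * (z - x) - F 3 x * (z - x) ^ 2 / 2)
    (x := x) (y := y) (B := M * |y - x| ^ 3)
    (fun z => by
      have h1 := (hasDerivAt_id' z).sub_const x
      refine ((((hF 0 z).fun_sub (h1.const_mul (F 1 x))).fun_sub
        (((h1.fun_pow 2).const_mul (F 2 x)).div_const 2)).fun_sub
        (((h1.fun_pow 3).const_mul (F 3 x)).div_const 6)).congr_deriv ?_
      simp; ring)
    (fun z hz => ((hF.shift 1).taylor_three (forall_uIcc_left hz h)).trans
      (by have := abs_sub_le_of_mem_uIcc hz; gcongr))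
  calc _ = |F 0 y - F 1 x * (y - x) - F 2 x * (y - x) ^ 2 / 2 - F 3 x * (y - x) ^ 3 / 6
        - (F 0 x - F 1 x * (x - x) - F 2 x * (x - x) ^ 2 / 2 - F 3 x * (x - x) ^ 3 / 6)| := by
        congr 1; ring
    _ ≤ M * |y - x| ^ 3 * |y - x| := this
    _ = _ := by ring

lemma slope_sub_mid_le (hF : DerivSeq F) {a b : ℝ} (hab : a < b)
    (h : ∀ z ∈ Set.Icc a b, |F 3 z| ≤ M) :
    |(F 0 b - F 0 a) / (b - a) - F 1 ((a + b) / 2)| ≤ M * (b - a) ^ 2 := by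
  have hd : 0 < b - a := by linarith
  have hM : 0 ≤ M := (abs_nonneg _).trans (h a ⟨le_rfl, hab.le⟩)
  have h1 := hF.taylor_three (x := (a + b) / 2) (y := b) (M := M) (fun z hz => h z (by
    rw [Set.uIcc_of_le (by linarith)] at hz; constructor <;> linarith [hz.1, hz.2]))
  have h2 := hF.taylor_three (x := (a + b) / 2) (y := a) (M := M) (fun z hz => h z (by
    rw [Set.uIcc_of_ge (by linarith)] at hz; constructor <;> linarith [hz.1, hz.2]))
  rw [show b - (a + b) / 2 = (b - a) / 2 by ring, abs_of_pos (a := (b - a) / 2) (by linarith)] at h1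
  rw [show a - (a + b) / 2 = -((b - a) / 2) by ring, abs_neg,
    abs_of_pos (a := (b - a) / 2) (by linarith)] at h2
  have h3 : (F 0 b - F 0 a) / (b - a) - F 1 ((a + b) / 2)
      = (F 0 b - F 0 a - F 1 ((a + b) / 2) * (b - a)) / (b - a) := by field_simp
  rw [h3, abs_div, abs_of_pos hd, div_le_iff₀ hd]
  have h4 : 0 ≤ M * (b - a) ^ 3 := by positivity
  rw [abs_le] at h1 h2 ⊢
  constructor <;> nlinarith [h1.1, h1.2, h2.1, h2.2]

lemma avg_sub_mid_le (hF : DerivSeq F) {a b : ℝ} (hab : a < b)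
    (h : ∀ z ∈ Set.Icc a b, |F 2 z| ≤ M) :
    |1 / (b - a) * (∫ s in a..b, F 0 s) - F 0 ((a + b) / 2)| ≤ M * (b - a) ^ 2 := by
  have := (hF.prim_derivSeq a).slope_sub_mid_le hab (M := M) h
  simpa [prim, div_eq_inv_mul] using this

lemma slope_le (hF : DerivSeq F) {a b : ℝ} (hab : a < b)
    (h : ∀ z ∈ Set.Icc a b, |F 1 z| ≤ M) : |(F 0 b - F 0 a) / (b - a)| ≤ M := by
  have hd : 0 < b - a := by linarith
  have := hF.taylor_one (x := a) (y := b) (M := M) (by rwa [Set.uIcc_of_le hab.le])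
  rw [abs_of_pos hd] at this
  rwa [abs_div, abs_of_pos hd, div_le_iff₀ hd]

lemma slope_sub_left_le (hF : DerivSeq F) {a b : ℝ} (hab : a < b)
    (h : ∀ z ∈ Set.Icc a b, |F 2 z| ≤ M) :
    |(F 0 b - F 0 a) / (b - a) - F 1 a| ≤ M * (b - a) := by
  have hd : 0 < b - a := by linarith
  have := hF.taylor_two (x := a) (y := b) (M := M) (by rwa [Set.uIcc_of_le hab.le])
  rw [abs_of_pos hd] at this
  rw [show (F 0 b - F 0 a) / (b - a) - F 1 a = (F 0 b - F 0 a - F 1 a * (b - a)) / (b - a) by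
    field_simp, abs_div, abs_of_pos hd, div_le_iff₀ hd]
  linarith

lemma slope_sub_right_le (hF : DerivSeq F) {a b : ℝ} (hab : a < b)
    (h : ∀ z ∈ Set.Icc a b, |F 2 z| ≤ M) :
    |(F 0 b - F 0 a) / (b - a) - F 1 b| ≤ M * (b - a) := by
  have hd : 0 < b - a := by linarith
  have := hF.taylor_two (x := b) (y := a) (M := M) (by rwa [Set.uIcc_of_ge hab.le])
  rw [abs_sub_comm a b, abs_of_pos hd] at this
  rw [show (F 0 b - F 0 a) / (b - a) - F 1 b = -((F 0 a - F 0 b - F 1 b * (a - b)) / (b - a)) by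
    field_simp; ring, abs_neg, abs_div, abs_of_pos hd, div_le_iff₀ hd]
  linarith

lemma half_avg_le (hF : DerivSeq F) {s : ℝ} (h : ∀ z ∈ Set.uIcc x (x + s), |F 2 z| ≤ M) :
    |(∫ z in x..(x + s), F 0 z) - s * F 0 x - s ^ 2 / 2 * F 1 (x + s)| ≤ 2 * M * |s| ^ 3 := by
  have hM := nonneg_of_bound h
  have h1 := (hF.prim_derivSeq x).taylor_three (x := x) (y := x + s) (M := M) h
  have h2 := (hF.shift 1).taylor_one (x := x) (y := x + s) (M := M) h
  simp only [prim, intervalIntegral.integral_same, add_sub_cancel_left] at h1 h2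
  have h3 : |s ^ 2 / 2 * (F 1 (x + s) - F 1 x)| ≤ M * |s| ^ 3 := by
    rw [abs_mul, abs_of_nonneg (by positivity : 0 ≤ s ^ 2 / 2), ← sq_abs s]
    have : 0 ≤ |s| := abs_nonneg s
    calc |s| ^ 2 / 2 * |F 1 (x + s) - F 1 x| ≤ |s| ^ 2 / 2 * (M * |s|) := by
          gcongr
      _ ≤ M * |s| ^ 3 := by nlinarith [mul_nonneg hM (pow_nonneg this 3)]
  calc _ = |((∫ z in x..(x + s), F 0 z) - 0 - F 0 x * s - F 1 x * s ^ 2 / 2)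
        - s ^ 2 / 2 * (F 1 (x + s) - F 1 x)| := by congr 1; ring
    _ ≤ _ := (abs_sub _ _).trans (by linarith)

lemma dual_avg_le (hF : DerivSeq F) {a b H : ℝ} (hax : a < x) (hxb : x < b)
    (ha : x - a ≤ H) (hb : b - x ≤ H) (h : ∀ z ∈ Set.Icc a b, |F 2 z| ≤ M) :
    |1 / ((b - a) / 2) * (∫ z in ((a + x) / 2)..((x + b) / 2), F 0 z) - F 0 x
      - ((b - x) ^ 2 / 8 * F 1 ((x + b) / 2) - (x - a) ^ 2 / 8 * F 1 ((a + x) / 2))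
        / ((b - a) / 2)| ≤ M * H ^ 2 := by
  have hM : 0 ≤ M := (abs_nonneg _).trans (h a ⟨le_rfl, by linarith⟩)
  have h1 := hF.half_avg_le (x := x) (s := (b - x) / 2) (M := M) (fun z hz => h z (by
    rw [Set.uIcc_of_le (by linarith)] at hz; constructor <;> linarith [hz.1, hz.2]))
  have h2 := hF.half_avg_le (x := x) (s := -((x - a) / 2)) (M := M) (fun z hz => h z (by
    rw [Set.uIcc_of_ge (by linarith)] at hz; constructor <;> linarith [hz.1, hz.2]))
  rw [show x + (b - x) / 2 = (x + b) / 2 by ring, abs_of_pos (a := (b - x) / 2) (by linarith)] at h1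
  rw [show x + -((x - a) / 2) = (a + x) / 2 by ring, abs_neg,
    abs_of_pos (a := (x - a) / 2) (by linarith)] at h2
  have hd : 0 < (b - a) / 2 := by linarith
  have h3 := intervalIntegral.integral_interval_sub_left
    ((hF.continuous 0).intervalIntegrable (μ := volume) x ((x + b) / 2))
    ((hF.continuous 0).intervalIntegrable x ((a + x) / 2))
  rw [← h3]
  set I := ∫ z in x..((x + b) / 2), F 0 z
  set J := ∫ z in x..((a + x) / 2), F 0 z
  have hq : ∀ p q r d : ℝ, 0 < d → 1 / d * r - p - q / d = (r - p * d - q) / d := by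
    intro p q r d hd
    rw [sub_div, sub_div, mul_div_cancel_right₀ _ hd.ne', one_div_mul_eq_div]
  rw [hq _ _ _ _ hd, abs_div, abs_of_pos hd, div_le_iff₀ hd]
  have e1 : ((b - x) / 2) ^ 3 ≤ H ^ 2 / 4 * ((b - x) / 2) := by
    have := pow_le_pow_left₀ (by linarith : 0 ≤ b - x) hb 2
    nlinarith
  have e2 : ((x - a) / 2) ^ 3 ≤ H ^ 2 / 4 * ((x - a) / 2) := by
    have := pow_le_pow_left₀ (by linarith : 0 ≤ x - a) ha 2
    nlinarith
  have e3 := mul_le_mul_of_nonneg_left e1 hM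
  have e4 := mul_le_mul_of_nonneg_left e2 hM
  have e5 : 0 ≤ M * H ^ 2 * ((b - a) / 2) := by positivity
  rw [abs_le] at h1 h2 ⊢
  constructor <;> nlinarith [h1.1, h1.2, h2.1, h2.2]

lemma corrected_avg_le (hF : DerivSeq F) {k : ℝ} (hk : k ≠ 0)
    (h : ∀ z ∈ Set.uIcc x (x + k), |F 3 z| ≤ M) :
    |1 / k * (∫ z in x..(x + k), F 0 z) - k ^ 2 / 6 * F 2 (x + k / 2) - F 0 x - k / 2 * F 1 x|
      ≤ 2 * M * |k| ^ 3 := by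
  have hM := nonneg_of_bound h
  have hk' : 0 < |k| := abs_pos.mpr hk
  have h1 := (hF.prim_derivSeq x).taylor_four (x := x) (y := x + k) (M := M) h
  have hmem : x + k / 2 ∈ Set.uIcc x (x + k) := by
    rcases le_total 0 k with hk | hk
    · rw [Set.uIcc_of_le (by linarith)]; constructor <;> linarith
    · rw [Set.uIcc_of_ge (by linarith)]; constructor <;> linarith
  have h2 := (hF.shift 2).taylor_one (x := x) (y := x + k / 2) (M := M)
    (forall_uIcc_left hmem h)
  simp only [prim, intervalIntegral.integral_same, add_sub_cancel_left, zero_add] at h1 h2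
  have h3 : |k ^ 2 / 6 * (F 2 (x + k / 2) - F 2 x)| ≤ M * |k| ^ 3 := by
    rw [abs_mul, abs_of_nonneg (by positivity : 0 ≤ k ^ 2 / 6), ← sq_abs k]
    rw [abs_div, abs_two] at h2
    calc |k| ^ 2 / 6 * |F 2 (x + k / 2) - F 2 x| ≤ |k| ^ 2 / 6 * (M * (|k| / 2)) := by gcongr
      _ ≤ M * |k| ^ 3 := by nlinarith [mul_nonneg hM (pow_nonneg hk'.le 3)]
  have h4 : |1 / k * ((∫ z in x..(x + k), F 0 z) - 0 - F 0 x * k - F 1 x * k ^ 2 / 2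
      - F 2 x * k ^ 3 / 6)| ≤ M * |k| ^ 3 := by
    rw [abs_mul, abs_div, abs_one, one_div_mul_eq_div, div_le_iff₀ hk']
    linarith
  calc _ = |1 / k * ((∫ z in x..(x + k), F 0 z) - 0 - F 0 x * k - F 1 x * k ^ 2 / 2
      - F 2 x * k ^ 3 / 6) - k ^ 2 / 6 * (F 2 (x + k / 2) - F 2 x)| := by
        congr 1; field_simp; ring
    _ ≤ _ := (abs_sub _ _).trans (by linarith)

end DerivSeq

end RMAC

namespace RMAC

/-! ### Sums over integer intervals -/

lemma sum_Icc_zero_sub_one (N : ℕ) (f : ℤ → ℝ) :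
    ∑ i ∈ Icc (0 : ℤ) ((N : ℤ) - 1), f i = ∑ i ∈ range N, f (i : ℤ) := by
  refine (Finset.sum_bij (fun (i : ℕ) _ => (i : ℤ)) ?_ ?_ ?_ ?_).symm
  · intro i hi; simp at hi ⊢; omega
  · intro a _ b _ h; exact_mod_cast h
  · intro b hb
    simp at hb
    exact ⟨b.toNat, by simp; omega, by simp; omega⟩
  · intros; rfl

lemma Ico_zero_eq_Icc (N : ℤ) : Ico (0 : ℤ) N = Icc (0 : ℤ) (N - 1) := by
  ext; simp

lemma sum_Icc_zero_eq_add_Icc_one {N : ℕ} (hN : 1 ≤ N) (f : ℤ → ℝ) :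
    ∑ i ∈ Icc (0 : ℤ) ((N : ℤ) - 1), f i = f 0 + ∑ i ∈ Icc (1 : ℤ) ((N : ℤ) - 1), f i := by
  rw [show Icc (0 : ℤ) ((N : ℤ) - 1) = insert 0 (Icc (1 : ℤ) ((N : ℤ) - 1)) by
    ext; simp; omega, sum_insert (by simp)]

lemma sum_Icc_zero_succ (N : ℕ) (f : ℤ → ℝ) :
    ∑ i ∈ Icc (0 : ℤ) (N : ℤ), f i = ∑ i ∈ Icc (0 : ℤ) ((N : ℤ) - 1), f i + f N := by
  rw [show Icc (0 : ℤ) (N : ℤ) = insert (N : ℤ) (Icc (0 : ℤ) ((N : ℤ) - 1)) by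
    ext; simp; omega, sum_insert (by simp), add_comm]

lemma sum_Icc_telescope (N : ℕ) (f : ℤ → ℝ) :
    ∑ i ∈ Icc (0 : ℤ) ((N : ℤ) - 1), (f (i + 1) - f i) = f N - f 0 := by
  rw [sum_Icc_zero_sub_one]
  simpa using Finset.sum_range_sub (fun i : ℕ => f i) N

lemma sum_Ico_add_one {i : ℤ} (hi : 0 ≤ i) (f : ℤ → ℝ) :
    ∑ l ∈ Ico 0 (i + 1), f l = ∑ l ∈ Ico 0 i, f l + f i := by
  rw [show Ico (0 : ℤ) (i + 1) = insert i (Ico 0 i) by ext; simp; omega,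
    sum_insert (by simp), add_comm]

/-- Summation by parts with values `v` vanishing at both end nodes. -/
lemma sum_by_parts_nodes {N : ℕ} (hN : 1 ≤ N) (q v : ℤ → ℝ) (h0 : v 0 = 0) (h1 : v N = 0) :
    ∑ i ∈ Icc (1 : ℤ) ((N : ℤ) - 1), (q i - q (i - 1)) * v i
      = -∑ i ∈ Icc (0 : ℤ) ((N : ℤ) - 1), q i * (v (i + 1) - v i) := by
  have e := sum_Icc_zero_eq_add_Icc_one hN fun i => (q i - q (i - 1)) * v i
  have t := sum_Icc_telescope N fun i => q (i - 1) * v i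
  have s : ∑ i ∈ Icc (0 : ℤ) ((N : ℤ) - 1), (q (i + 1 - 1) * v (i + 1) - q (i - 1) * v i)
      = ∑ i ∈ Icc (0 : ℤ) ((N : ℤ) - 1), (q i - q (i - 1)) * v i
        + ∑ i ∈ Icc (0 : ℤ) ((N : ℤ) - 1), q i * (v (i + 1) - v i) := by
    rw [← sum_add_distrib]
    refine sum_congr rfl fun i _ => ?_
    rw [add_sub_cancel_right]; ring
  simp only [h0, h1, mul_zero, zero_add, sub_self] at e t
  linarith

/-- Summation by parts with values `v` vanishing at both ghost cells. -/
lemma sum_by_parts_cells (N : ℕ) (F v : ℤ → ℝ) (h0 : v (-1) = 0) (h1 : v N = 0) :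
    ∑ j ∈ Icc (0 : ℤ) ((N : ℤ) - 1), (F (j + 1) - F j) * v j
      = -∑ j ∈ Icc (0 : ℤ) (N : ℤ), F j * (v j - v (j - 1)) := by
  have t := sum_Icc_telescope N fun j => F j * v (j - 1)
  have s : ∑ i ∈ Icc (0 : ℤ) ((N : ℤ) - 1), (F (i + 1) * v (i + 1 - 1) - F i * v (i - 1))
      = ∑ j ∈ Icc (0 : ℤ) ((N : ℤ) - 1), (F (j + 1) - F j) * v j
        + ∑ j ∈ Icc (0 : ℤ) ((N : ℤ) - 1), F j * (v j - v (j - 1)) := by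
    rw [← sum_add_distrib]
    refine sum_congr rfl fun i _ => ?_
    rw [add_sub_cancel_right]; ring
  rw [sum_Icc_zero_succ, h1]
  simp only [zero_sub, h0, mul_zero, sub_zero] at t
  linarith

/-! ### Basic properties of the grid -/

namespace Grid

/-- The grid with the two coordinate directions exchanged. -/
def swap (G : Grid) : Grid where
  Nx := G.Ny
  Ny := G.Nx
  Lx := G.Ly
  Ly := G.Lx
  xp := G.yp
  yp := G.xp
  one_le_Nx := G.one_le_Ny
  one_le_Ny := G.one_le_Nx
  xp_zero := G.yp_zero
  xp_last := G.yp_last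
  yp_zero := G.xp_zero
  yp_last := G.xp_last
  xp_mono := G.yp_mono
  yp_mono := G.xp_mono

variable (G : Grid)

lemma hh_pos {i : ℤ} (h0 : 0 ≤ i) (h1 : i < G.Nx) : 0 < G.hh i := by
  have := G.xp_mono i h0 h1
  unfold hh; linarith

lemma hh_le_hmax {i : ℤ} (h0 : 0 ≤ i) (h1 : i < G.Nx) : G.hh i ≤ G.hmax :=
  Finset.le_sup' G.hh (Finset.mem_Icc.mpr ⟨h0, by omega⟩)

lemma xp_le_xp {i k : ℤ} (h0 : 0 ≤ i) (hik : i ≤ k) (hk : k ≤ G.Nx) : G.xp i ≤ G.xp k := by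
  induction k, hik using Int.leInduction with
  | base => exact le_rfl
  | succ k hk' ih => exact (ih (by omega)).trans (G.xp_mono k (by omega) (by omega)).le

lemma xp_mem {i : ℤ} (h0 : 0 ≤ i) (h1 : i ≤ G.Nx) : G.xp i ∈ Set.Icc 0 G.Lx := by
  constructor
  · rw [← G.xp_zero]; exact G.xp_le_xp le_rfl h0 h1
  · rw [← G.xp_last]; exact G.xp_le_xp h0 h1 le_rfl

lemma xh_mem_Ioo {i : ℤ} (h0 : 0 ≤ i) (h1 : i < G.Nx) : G.xh i ∈ Set.Ioo 0 G.Lx := by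
  have a := G.xp_mem h0 h1.le
  have b := G.xp_mem (i := i + 1) (by omega) (by omega)
  have c := G.xp_mono i h0 h1
  unfold xh
  constructor <;> linarith [a.1, a.2, b.1, b.2]

lemma xh_mem {i : ℤ} (h0 : 0 ≤ i) (h1 : i < G.Nx) : G.xh i ∈ Set.Icc 0 G.Lx :=
  Set.Ioo_subset_Icc_self (G.xh_mem_Ioo h0 h1)

lemma Icc_xp_subset {i k : ℤ} (h0 : 0 ≤ i) (h1 : k ≤ G.Nx) (hik : i ≤ k) :
    Set.Icc (G.xp i) (G.xp k) ⊆ Set.Icc 0 G.Lx :=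
  Set.Icc_subset_Icc (G.xp_mem h0 (by omega)).1 (G.xp_mem (by omega) h1).2

lemma hc_eq {i : ℤ} (h0 : 0 < i) (h1 : i < G.Nx) : G.hc i = (G.xp (i + 1) - G.xp (i - 1)) / 2 := by
  unfold hc hh
  rw [if_neg (by omega), if_neg (by omega), sub_add_cancel]
  ring

lemma hc_zero : G.hc 0 = G.hh 0 / 2 := by simp [hc]

lemma hc_last : G.hc G.Nx = G.hh (G.Nx - 1) / 2 := by
  have := G.one_le_Nx
  rw [hc, if_neg (by omega), if_pos rfl]

lemma hc_pos {i : ℤ} (h0 : 0 ≤ i) (h1 : i ≤ G.Nx) : 0 < G.hc i := by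
  have := G.one_le_Nx
  rcases h0.eq_or_lt with rfl | h0
  · rw [hc_zero]; linarith [G.hh_pos le_rfl (by omega)]
  rcases h1.eq_or_lt with rfl | h1
  · rw [hc_last]; linarith [G.hh_pos (i := (G.Nx : ℤ) - 1) (by omega) (by omega)]
  · rw [G.hc_eq h0 h1]
    linarith [G.xp_mono i (by omega) h1, G.xp_le_xp (i := i - 1) (k := i) (by omega) (by omega) h1.le]

lemma sum_hh : ∑ i ∈ Icc (0 : ℤ) ((G.Nx : ℤ) - 1), G.hh i = G.Lx := by
  have := sum_Icc_telescope G.Nx G.xp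
  rwa [G.xp_zero, G.xp_last, sub_zero] at this

lemma Lx_pos : 0 < G.Lx := by
  rw [← G.sum_hh]
  refine Finset.sum_pos (fun i hi => ?_) ⟨0, ?_⟩
  · rw [mem_Icc] at hi; exact G.hh_pos hi.1 (by omega)
  · have := G.one_le_Nx
    rw [mem_Icc]; omega

lemma sum_hc : ∑ i ∈ Icc (0 : ℤ) (G.Nx : ℤ), G.hc i = G.Lx := by
  have hN := G.one_le_Nx
  rw [sum_Icc_zero_succ, sum_Icc_zero_eq_add_Icc_one hN, hc_zero, hc_last]
  have s : ∑ i ∈ Icc (1 : ℤ) ((G.Nx : ℤ) - 1), G.hc i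
      = G.xh (G.Nx - 1) - G.xh 0 := by
    have e := sum_Icc_zero_eq_add_Icc_one hN fun i => G.xh (i - 1 + 1) - G.xh (i - 1)
    have t := sum_Icc_telescope G.Nx fun i => G.xh (i - 1)
    have c : ∑ i ∈ Icc (1 : ℤ) ((G.Nx : ℤ) - 1), G.hc i
        = ∑ i ∈ Icc (1 : ℤ) ((G.Nx : ℤ) - 1), (G.xh (i - 1 + 1) - G.xh (i - 1)) := by
      refine sum_congr rfl fun i hi => ?_
      rw [mem_Icc] at hi
      rw [G.hc_eq (by omega) (by omega)]
      simp only [xh, sub_add_cancel]; ring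
    simp only [sub_add_cancel, add_sub_cancel_right] at e t c
    rw [c]
    simp only [zero_sub] at e t
    linarith
  rw [s]
  have a := G.xp_zero
  have b := G.xp_last
  simp only [hh, xh, sub_add_cancel, zero_add]
  linarith

lemma sum_hc_interior_le : ∑ i ∈ Icc (1 : ℤ) ((G.Nx : ℤ) - 1), G.hc i ≤ G.Lx := by
  rw [← G.sum_hc]
  refine sum_le_sum_of_subset_of_nonneg (Icc_subset_Icc (by simp) (by simp)) fun i hi _ => ?_
  rw [mem_Icc] at hi
  exact (G.hc_pos hi.1 hi.2).le

lemma swap_ipTM (f g : ℤ → ℤ → ℝ) :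
    G.swap.ipTM (fun i j => f j i) (fun i j => g j i) = G.ipMT f g := by
  unfold ipTM ipMT
  rw [sum_comm]
  refine sum_congr rfl fun i _ => sum_congr rfl fun j _ => ?_
  rw [mul_comm (G.hh i)]; rfl

lemma swap_ipM (f g : ℤ → ℤ → ℝ) :
    G.swap.ipM (fun i j => f j i) (fun i j => g j i) = G.ipM f g := by
  unfold ipM
  rw [sum_comm]
  refine sum_congr rfl fun i _ => sum_congr rfl fun j _ => ?_
  rw [mul_comm (G.hh i)]; rfl

/-- A pointwise bound of a density on the interior x-edges bounds its weighted sum. -/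
lemma sum_edges_le {f : ℤ → ℤ → ℝ} {B : ℝ} (hB : 0 ≤ B)
    (h : ∀ i ∈ Icc (1 : ℤ) ((G.Nx : ℤ) - 1), ∀ j ∈ Icc (0 : ℤ) ((G.Ny : ℤ) - 1), f i j ≤ B) :
    ∑ i ∈ Icc (1 : ℤ) ((G.Nx : ℤ) - 1), ∑ j ∈ Icc (0 : ℤ) ((G.Ny : ℤ) - 1),
      G.hc i * G.kk j * f i j ≤ G.Lx * G.Ly * B := by
  have e : ∑ i ∈ Icc (1 : ℤ) ((G.Nx : ℤ) - 1), ∑ j ∈ Icc (0 : ℤ) ((G.Ny : ℤ) - 1),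
      G.hc i * G.kk j * B
      = (∑ i ∈ Icc (1 : ℤ) ((G.Nx : ℤ) - 1), G.hc i) * G.Ly * B := by
    rw [← show _ = G.Ly from G.swap.sum_hh, sum_mul_sum, sum_mul]
    refine sum_congr rfl fun i _ => ?_
    rw [sum_mul]; rfl
  refine (sum_le_sum fun i hi => sum_le_sum fun j hj => ?_).trans (e.trans_le ?_)
  · exact mul_le_mul_of_nonneg_left (h i hi j hj) (by
      rw [mem_Icc] at hi hj
      exact mul_nonneg (G.hc_pos (by omega) (by omega)).le
        (G.swap.hh_pos hj.1 (by show j < G.Ny; omega)).le)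
  · have := G.swap.Lx_pos
    exact mul_le_mul_of_nonneg_right (mul_le_mul_of_nonneg_right G.sum_hc_interior_le
      this.le) hB

end Grid
end RMAC

namespace RMAC
namespace Grid
variable (G : Grid)

/-! ### The discrete energy estimate -/

lemma kk_pos {j : ℤ} (h0 : 0 ≤ j) (h1 : j < G.Ny) : 0 < G.kk j := G.swap.hh_pos h0 h1

lemma kc_pos {j : ℤ} (h0 : 0 ≤ j) (h1 : j ≤ G.Ny) : 0 < G.kc j := G.swap.hc_pos h0 h1

lemma Ly_pos : 0 < G.Ly := G.swap.Lx_pos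

lemma ipTM_DxC {v q : ℤ → ℤ → ℝ}
    (hb : ∀ j ∈ Icc (0 : ℤ) ((G.Ny : ℤ) - 1), v 0 j = 0 ∧ v G.Nx j = 0) :
    G.ipTM (G.DxC q) v = -G.ipM q (G.dxEx v) := by
  unfold ipTM ipM
  rw [sum_comm, sum_comm (s := Icc (0 : ℤ) ((G.Nx : ℤ) - 1)), ← sum_neg_distrib]
  refine sum_congr rfl fun j hj => ?_
  have s := sum_by_parts_nodes G.one_le_Nx (fun i => q i j) (fun i => v i j)
    (hb j hj).1 (hb j hj).2
  calc _ = G.kk j * ∑ i ∈ Icc (1 : ℤ) ((G.Nx : ℤ) - 1), (q i j - q (i - 1) j) * v i j := by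
        rw [mul_sum]
        refine sum_congr rfl fun i hi => ?_
        rw [mem_Icc] at hi
        have := (G.hc_pos (i := i) (by omega) (by omega)).ne'
        unfold DxC; field_simp
    _ = _ := by
        rw [s, mul_neg, mul_sum]
        congr 1
        refine sum_congr rfl fun i hi => ?_
        rw [mem_Icc] at hi
        have := (G.hh_pos (i := i) (by omega) (by omega)).ne'
        unfold dxEx; field_simp

lemma ipTM_DyN {v F : ℤ → ℤ → ℝ}
    (hb : ∀ i ∈ Icc (1 : ℤ) ((G.Nx : ℤ) - 1), v i (-1) = 0 ∧ v i G.Ny = 0) :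
    G.ipTM (fun i j => (F i (j + 1) - F i j) / G.kk j) v = -G.ipTy F (G.DyEx v) := by
  unfold ipTM ipTy
  rw [← sum_neg_distrib]
  refine sum_congr rfl fun i hi => ?_
  have s := sum_by_parts_cells G.Ny (F i) (v i) (hb i hi).1 (hb i hi).2
  calc _ = G.hc i * ∑ j ∈ Icc (0 : ℤ) ((G.Ny : ℤ) - 1), (F i (j + 1) - F i j) * v i j := by
        rw [mul_sum]
        refine sum_congr rfl fun j hj => ?_
        rw [mem_Icc] at hj
        have := (G.kk_pos (j := j) (by omega) (by omega)).ne'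
        field_simp
    _ = _ := by
        rw [s, mul_neg, mul_sum]
        congr 1
        refine sum_congr rfl fun j hj => ?_
        rw [mem_Icc] at hj
        have := (G.kc_pos (j := j) (by omega) (by omega)).ne'
        unfold DyEx; field_simp

lemma neg_mul_le_of_abs_sub_le {a b ε : ℝ} (h : |a - b| ≤ ε) : -(a * b) ≤ ε ^ 2 / 4 := by
  have : (a - b) ^ 2 ≤ ε ^ 2 := sq_le_sq' (by linarith [abs_le.mp h]) (abs_le.mp h).2
  nlinarith [sq_nonneg (a + b)]

lemma neg_ipM_le {E d : ℤ → ℤ → ℝ} {ε : ℝ}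
    (h : ∀ i ∈ Icc (0 : ℤ) ((G.Nx : ℤ) - 1), ∀ j ∈ Icc (0 : ℤ) ((G.Ny : ℤ) - 1),
      |E i j - d i j| ≤ ε) : -G.ipM E d ≤ G.Lx * G.Ly * (ε ^ 2 / 4) := by
  unfold ipM
  rw [← G.sum_hh, ← show _ = G.Ly from G.swap.sum_hh, sum_mul_sum, sum_mul, ← sum_neg_distrib]
  refine sum_le_sum fun i hi => ?_
  rw [sum_mul, ← sum_neg_distrib]
  refine sum_le_sum fun j hj => ?_
  have h1 := neg_mul_le_of_abs_sub_le (h i hi j hj)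
  rw [mem_Icc] at hi hj
  have h2 := mul_pos (G.hh_pos hi.1 (by omega)) (G.kk_pos hj.1 (by omega))
  calc _ = G.hh i * G.kk j * -(E i j * d i j) := by ring
    _ ≤ _ := mul_le_mul_of_nonneg_left h1 h2.le

lemma neg_ipTy_le {E d : ℤ → ℤ → ℝ} {ε : ℝ}
    (h : ∀ i ∈ Icc (1 : ℤ) ((G.Nx : ℤ) - 1), ∀ j ∈ Icc (0 : ℤ) (G.Ny : ℤ),
      |E i j - d i j| ≤ ε) : -G.ipTy E d ≤ G.Lx * G.Ly * (ε ^ 2 / 4) := by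
  have h0 : (∑ i ∈ Icc (1 : ℤ) ((G.Nx : ℤ) - 1), G.hc i) * G.Ly * (ε ^ 2 / 4)
      ≤ G.Lx * G.Ly * (ε ^ 2 / 4) :=
    mul_le_mul_of_nonneg_right (mul_le_mul_of_nonneg_right G.sum_hc_interior_le
      G.Ly_pos.le) (by positivity)
  refine le_trans ?_ h0
  unfold ipTy
  rw [← show _ = G.Ly from G.swap.sum_hc, sum_mul_sum, sum_mul, ← sum_neg_distrib]
  refine sum_le_sum fun i hi => ?_
  rw [sum_mul, ← sum_neg_distrib]
  refine sum_le_sum fun j hj => ?_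
  have h1 := neg_mul_le_of_abs_sub_le (h i hi j hj)
  rw [mem_Icc] at hi hj
  have h2 := mul_pos (G.hc_pos (i := i) (by omega) (by omega)) (G.kc_pos hj.1 (by omega))
  calc _ = G.hc i * G.kc j * -(E i j * d i j) := by ring
    _ ≤ _ := mul_le_mul_of_nonneg_left h1 h2.le

/-- Energy inequality for one component of the discrete momentum equation, with fluxes `E`, `F`
that are perturbations of the discrete gradient of `v`. -/
lemma energy_component {μ Δt ε σ : ℝ} (hμ : 0 ≤ μ) (hΔt : 0 < Δt) {v o q E F S : ℤ → ℤ → ℝ}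
    (hbx : ∀ j ∈ Icc (0 : ℤ) ((G.Ny : ℤ) - 1), v 0 j = 0 ∧ v G.Nx j = 0)
    (hby : ∀ i ∈ Icc (1 : ℤ) ((G.Nx : ℤ) - 1), v i (-1) = 0 ∧ v i G.Ny = 0)
    (heq : ∀ i ∈ Icc (1 : ℤ) ((G.Nx : ℤ) - 1), ∀ j ∈ Icc (0 : ℤ) ((G.Ny : ℤ) - 1),
      (v i j - o i j) / Δt + G.DxC q i j
        = μ * G.DxC E i j + μ * ((F i (j + 1) - F i j) / G.kk j) + S i j)
    (hE : ∀ i ∈ Icc (0 : ℤ) ((G.Nx : ℤ) - 1), ∀ j ∈ Icc (0 : ℤ) ((G.Ny : ℤ) - 1),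
      |E i j - G.dxEx v i j| ≤ ε)
    (hF : ∀ i ∈ Icc (1 : ℤ) ((G.Nx : ℤ) - 1), ∀ j ∈ Icc (0 : ℤ) (G.Ny : ℤ),
      |F i j - G.DyEx v i j| ≤ ε)
    (hS : ∀ i ∈ Icc (1 : ℤ) ((G.Nx : ℤ) - 1), ∀ j ∈ Icc (0 : ℤ) ((G.Ny : ℤ) - 1),
      |S i j| ≤ σ) :
    G.ipTM v v ≤ G.ipTM o o + 2 * Δt * G.ipM q (G.dxEx v)
      + Δt * (G.ipTM v v + G.Lx * G.Ly * σ ^ 2 + μ * (G.Lx * G.Ly * ε ^ 2)) := by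
  have e1 := G.ipTM_DxC (q := q) hbx
  have e2 := G.ipTM_DxC (q := E) hbx
  have e3 := G.ipTM_DyN (F := F) hby
  have b1 := G.neg_ipM_le hE
  have b2 := G.neg_ipTy_le hF
  have b3 := G.sum_edges_le (f := fun _ _ => σ ^ 2) (sq_nonneg σ) (fun _ _ _ _ => le_rfl)
  have key : G.ipTM v v ≤ G.ipTM o o - 2 * Δt * G.ipTM (G.DxC q) v
      + 2 * Δt * μ * G.ipTM (G.DxC E) v
      + 2 * Δt * μ * G.ipTM (fun i j => (F i (j + 1) - F i j) / G.kk j) v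
      + Δt * G.ipTM v v
      + Δt * ∑ i ∈ Icc (1 : ℤ) ((G.Nx : ℤ) - 1), ∑ j ∈ Icc (0 : ℤ) ((G.Ny : ℤ) - 1),
          G.hc i * G.kk j * σ ^ 2 := by
    unfold ipTM
    simp only [mul_sum, ← sum_add_distrib, ← sum_sub_distrib]
    refine sum_le_sum fun i hi => sum_le_sum fun j hj => ?_
    have h := heq i hi j hj
    have hs := hS i hi j hj
    rw [mem_Icc] at hi hj
    have hw : 0 < G.hc i * G.kk j :=
      mul_pos (G.hc_pos (by omega) (by omega)) (G.kk_pos hj.1 (by omega))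
    set w := G.hc i * G.kk j
    set V := v i j
    set O := o i j
    set s := S i j
    set a := G.DxC q i j
    set b := G.DxC E i j
    set c := (F i (j + 1) - F i j) / G.kk j
    have h' : V - O = Δt * (μ * b + μ * c + s - a) := by
      rw [← h]; field_simp; ring
    have hs2 : s ^ 2 ≤ σ ^ 2 := sq_le_sq' (by linarith [abs_le.mp hs]) (abs_le.mp hs).2
    have h1 : V * V ≤ O * O + 2 * V * (V - O) := by nlinarith [sq_nonneg (V - O)]
    have h2 : 2 * V * s ≤ V * V + σ ^ 2 := by nlinarith [sq_nonneg (V - s)]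
    have h3 : V * V ≤ O * O + Δt * (2 * V * (μ * b + μ * c - a) + (V * V + σ ^ 2)) := by
      have := mul_le_mul_of_nonneg_left h2 hΔt.le
      rw [h'] at h1; linarith
    have h4 := mul_le_mul_of_nonneg_left h3 hw.le
    linarith
  rw [e1, e2, e3] at key
  have c1 := mul_le_mul_of_nonneg_left b1 (by positivity : 0 ≤ 2 * Δt * μ)
  have c2 := mul_le_mul_of_nonneg_left b2 (by positivity : 0 ≤ 2 * Δt * μ)
  have c3 := mul_le_mul_of_nonneg_left b3 hΔt.le
  linarith

/-- Discrete Gronwall inequality for the implicit Euler method. -/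
lemma implicit_gronwall {a : ℕ → ℝ} {Δt K : ℝ} {N : ℕ} (hΔt : 0 < Δt) (hΔt' : Δt ≤ 1 / 2)
    (hK : 0 ≤ K) (ha : ∀ n, 0 ≤ a n)
    (h : ∀ n, n + 1 ≤ N → a (n + 1) ≤ a n + Δt * (a (n + 1) + K)) :
    ∀ n ≤ N, a n ≤ Real.exp (2 * (n * Δt)) * (a 0 + 2 * (n * Δt) * K) := by
  intro n
  induction n with
  | zero => intro _; simp
  | succ n ih =>
    intro hn
    have h1 := ih (by omega)
    have h2 := h n hn
    have h3 : a (n + 1) ≤ (1 + 2 * Δt) * (a n + Δt * K) := by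
      have : 0 ≤ a n + Δt * K := add_nonneg (ha n) (by positivity)
      nlinarith [mul_nonneg hΔt.le (sub_nonneg.mpr hΔt'), ha (n + 1)]
    have h4 : 1 + 2 * Δt ≤ Real.exp (2 * Δt) := by linarith [Real.add_one_le_exp (2 * Δt)]
    have h5 : 1 ≤ Real.exp (2 * (n * Δt)) := Real.one_le_exp (by positivity)
    have h6 : a n + Δt * K ≤ Real.exp (2 * (n * Δt)) * (a 0 + 2 * ((n + 1) * Δt) * K) := by
      have : 0 ≤ Δt * K := by positivity
      nlinarith
    have h7 : 0 ≤ a n + Δt * K := add_nonneg (ha n) (by positivity)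
    calc a (n + 1) ≤ _ := h3
      _ ≤ Real.exp (2 * Δt) * (Real.exp (2 * (n * Δt)) * (a 0 + 2 * ((n + 1) * Δt) * K)) := by
        gcongr
      _ = _ := by
        rw [← mul_assoc, ← Real.exp_add]; push_cast; ring_nf

end Grid
end RMAC

namespace RMAC
namespace Grid
variable (G : Grid)

/-! ### A weighted summation operator vanishing at both ends -/

/-- Nodal values of the cubic increasing from `0` to `1` with vanishing slope at both ends. -/
def profile (i : ℤ) : ℝ := G.xp i ^ 2 * (3 * G.Lx - 2 * G.xp i) / G.Lx ^ 3

/-- Cell averages of the derivative of the cubic profile. -/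
def bump (i : ℤ) : ℝ := (G.profile (i + 1) - G.profile i) / G.hh i

/-- The weighted sum `∑ h_l³ b_l / 6`. -/
def moment (b : ℤ → ℝ) : ℝ := ∑ l ∈ Ico (0 : ℤ) G.Nx, G.hh l ^ 3 / 6 * b l

/-- Partial sums of `h_l³ b_l / 6`, corrected by a multiple of the profile so as to vanish at
both end nodes. -/
def cumsum (b : ℤ → ℝ) (i : ℤ) : ℝ :=
  ∑ l ∈ Ico (0 : ℤ) i, G.hh l ^ 3 / 6 * b l - G.profile i * G.moment b

lemma profile_nonneg {i : ℤ} (h0 : 0 ≤ i) (h1 : i ≤ G.Nx) : 0 ≤ G.profile i := by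
  have h := G.xp_mem h0 h1
  have hL := G.Lx_pos
  unfold profile
  have : 0 ≤ 3 * G.Lx - 2 * G.xp i := by linarith [h.1, h.2]
  positivity

lemma profile_le_one {i : ℤ} (h0 : 0 ≤ i) (h1 : i ≤ G.Nx) : G.profile i ≤ 1 := by
  have h := G.xp_mem h0 h1
  have hL := G.Lx_pos
  unfold profile
  rw [div_le_one (by positivity)]
  nlinarith [mul_nonneg (sq_nonneg (G.Lx - G.xp i)) (by linarith [h.1] : 0 ≤ G.Lx + 2 * G.xp i)]

lemma cumsum_zero (b : ℤ → ℝ) : G.cumsum b 0 = 0 := by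
  simp [cumsum, profile, G.xp_zero]

lemma cumsum_last (b : ℤ → ℝ) : G.cumsum b G.Nx = 0 := by
  have hL := G.Lx_pos.ne'
  have : G.profile G.Nx = 1 := by
    rw [profile, G.xp_last, div_eq_one_iff_eq (by positivity)]; ring
  rw [cumsum, this, moment]; ring

lemma bump_eq {i : ℤ} (h0 : 0 ≤ i) (h1 : i < G.Nx) :
    G.bump i = (3 * G.Lx * (G.xp i + G.xp (i + 1))
      - 2 * (G.xp i ^ 2 + G.xp i * G.xp (i + 1) + G.xp (i + 1) ^ 2)) / G.Lx ^ 3 := by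
  have hL := G.Lx_pos.ne'
  have hh := G.hh_pos h0 h1
  rw [bump, div_eq_iff hh.ne', profile, profile,
    show G.hh i = G.xp (i + 1) - G.xp i from rfl]
  field_simp
  ring

lemma abs_bump_le {i : ℤ} (h0 : 0 ≤ i) (h1 : i < G.Nx) : |G.bump i| ≤ 6 / G.Lx := by
  have hL := G.Lx_pos
  have a := G.xp_mem h0 h1.le
  have b := G.xp_mem (i := i + 1) (by omega) (by omega)
  obtain ⟨a0, a1⟩ := a
  obtain ⟨b0, b1⟩ := b
  rw [G.bump_eq h0 h1, abs_div, abs_of_pos (by positivity : 0 < G.Lx ^ 3),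
    div_le_div_iff₀ (by positivity) hL]
  have : |3 * G.Lx * (G.xp i + G.xp (i + 1))
      - 2 * (G.xp i ^ 2 + G.xp i * G.xp (i + 1) + G.xp (i + 1) ^ 2)| ≤ 6 * G.Lx ^ 2 := by
    rw [abs_le]; constructor <;> nlinarith [mul_nonneg a0 b0, mul_nonneg hL.le a0]
  nlinarith

/-- A difference quotient, over the dual cells, of cell values extended by zero to the two ghost
cells, expressed through its three cases. -/
lemma dual_quotient_le {f : ℤ → ℝ} {K : ℝ}
    (hl : |f 0| ≤ K * (G.hh 0 / 2)) (hr : |f (G.Nx - 1)| ≤ K * (G.hh (G.Nx - 1) / 2))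
    (hm : ∀ i : ℤ, 0 < i → i < G.Nx →
      |f i - f (i - 1)| ≤ K * ((G.xp (i + 1) - G.xp (i - 1)) / 2))
    {i : ℤ} (h0 : 0 ≤ i) (h1 : i ≤ G.Nx) :
    |((if i = -1 ∨ i = G.Nx then 0 else f i)
      - (if i - 1 = -1 ∨ i - 1 = G.Nx then 0 else f (i - 1))) / G.hc i| ≤ K := by
  have hN := G.one_le_Nx
  have hp := G.hc_pos h0 h1
  rw [abs_div, abs_of_pos hp, div_le_iff₀ hp]
  rcases h0.eq_or_lt with rfl | h0
  · rw [if_neg (by omega), if_pos (by omega), sub_zero, hc_zero]; exact hl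
  rcases h1.eq_or_lt with rfl | h1
  · rw [if_pos (by omega), if_neg (by omega), zero_sub, abs_neg, hc_last]; exact hr
  · rw [if_neg (by omega), if_neg (by omega), G.hc_eq h0 h1]; exact hm i h0 h1

lemma bump_dual_quotient_le {i : ℤ} (h0 : 0 ≤ i) (h1 : i ≤ G.Nx) :
    |((if i = -1 ∨ i = G.Nx then 0 else G.bump i)
      - (if i - 1 = -1 ∨ i - 1 = G.Nx then 0 else G.bump (i - 1))) / G.hc i| ≤ 6 / G.Lx ^ 2 := by
  have hN := G.one_le_Nx
  have hL := G.Lx_pos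
  have hK : ∀ x d : ℝ, 0 ≤ d → |x| ≤ 3 * G.Lx →
      |d * x / G.Lx ^ 3| ≤ 6 / G.Lx ^ 2 * (d / 2) := by
    intro x d hd hx
    rw [abs_div, abs_of_pos (by positivity : 0 < G.Lx ^ 3), div_le_iff₀ (by positivity), abs_mul,
      abs_of_nonneg hd]
    calc d * |x| ≤ d * (3 * G.Lx) := by gcongr
      _ = _ := by field_simp; ring
  refine G.dual_quotient_le ?_ ?_ ?_ h0 h1
  · rw [G.bump_eq le_rfl (by omega), zero_add]
    have b := G.xp_mem (i := 1) (by omega) (by omega)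
    have e : G.hh 0 = G.xp 1 := by simp [hh, G.xp_zero]
    rw [e, G.xp_zero, show 3 * G.Lx * (0 + G.xp 1) - 2 * (0 ^ 2 + 0 * G.xp 1 + G.xp 1 ^ 2)
      = G.xp 1 * (3 * G.Lx - 2 * G.xp 1) by ring]
    exact hK _ _ b.1 (by rw [abs_le]; constructor <;> linarith [b.1, b.2])
  · rw [G.bump_eq (by omega) (by omega), sub_add_cancel]
    have b := G.xp_mem (i := G.Nx - 1) (by omega) (by omega)
    have e : G.hh (G.Nx - 1) = G.Lx - G.xp (G.Nx - 1) := by simp [hh, G.xp_last]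
    rw [e, G.xp_last, show 3 * G.Lx * (G.xp (G.Nx - 1) + G.Lx) - 2 * (G.xp (G.Nx - 1) ^ 2
      + G.xp (G.Nx - 1) * G.Lx + G.Lx ^ 2)
      = (G.Lx - G.xp (G.Nx - 1)) * (G.Lx + 2 * G.xp (G.Nx - 1)) by ring]
    exact hK _ _ (by linarith [b.2]) (by rw [abs_le]; constructor <;> linarith [b.1, b.2])
  · intro i h0 h1
    rw [G.bump_eq h0.le h1, G.bump_eq (by omega) (by omega), sub_add_cancel]
    have a := G.xp_mem (i := i - 1) (by omega) (by omega)
    have b := G.xp_mem (i := i) (by omega) (by omega)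
    have c := G.xp_mem (i := i + 1) (by omega) (by omega)
    have d := G.xp_le_xp (i := i - 1) (k := i + 1) (by omega) (by omega) (by omega)
    rw [← sub_div, show ∀ x y z L : ℝ, 3 * L * (y + z) - 2 * (y ^ 2 + y * z + z ^ 2)
      - (3 * L * (x + y) - 2 * (x ^ 2 + x * y + y ^ 2)) = (z - x) * (3 * L - 2 * (x + y + z)) by
      intros; ring]
    exact hK _ _ (by linarith) (by
      rw [abs_le]; constructor <;> linarith [a.1, a.2, b.1, b.2, c.1, c.2])

lemma abs_sum_cubes_le {b : ℤ → ℝ} {β : ℝ} (hβ : 0 ≤ β)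
    (hb : ∀ l : ℤ, 0 ≤ l → l < G.Nx → |b l| ≤ β) {i : ℤ} (h1 : i ≤ G.Nx) :
    |∑ l ∈ Ico (0 : ℤ) i, G.hh l ^ 3 / 6 * b l| ≤ G.hmax ^ 2 / 6 * β * G.Lx := by
  rw [← G.sum_hh, ← Ico_zero_eq_Icc, mul_sum]
  refine (abs_sum_le_sum_abs _ _).trans ?_
  refine (sum_le_sum_of_subset_of_nonneg (Ico_subset_Ico_right h1) fun _ _ _ => abs_nonneg _).trans
    (sum_le_sum fun l hl => ?_)
  rw [mem_Ico] at hl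
  have hp := G.hh_pos hl.1 hl.2
  have hm := G.hh_le_hmax hl.1 hl.2
  rw [abs_mul, abs_of_pos (by positivity)]
  calc G.hh l ^ 3 / 6 * |b l| ≤ G.hh l ^ 3 / 6 * β := by gcongr; exact hb l hl.1 hl.2
    _ = G.hh l ^ 2 / 6 * β * G.hh l := by ring
    _ ≤ G.hmax ^ 2 / 6 * β * G.hh l := by gcongr

lemma abs_moment_le {b : ℤ → ℝ} {β : ℝ} (hβ : 0 ≤ β)
    (hb : ∀ l : ℤ, 0 ≤ l → l < G.Nx → |b l| ≤ β) :
    |G.moment b| ≤ G.hmax ^ 2 / 6 * β * G.Lx := G.abs_sum_cubes_le hβ hb le_rfl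

lemma abs_cumsum_le {b : ℤ → ℝ} {β : ℝ} (hβ : 0 ≤ β)
    (hb : ∀ l : ℤ, 0 ≤ l → l < G.Nx → |b l| ≤ β) {i : ℤ} (h0 : 0 ≤ i) (h1 : i ≤ G.Nx) :
    |G.cumsum b i| ≤ G.Lx * β * G.hmax ^ 2 := by
  have a := G.abs_sum_cubes_le hβ hb h1
  have c := G.abs_moment_le hβ hb
  have hL := G.Lx_pos
  have d : |G.profile i * G.moment b| ≤ G.hmax ^ 2 / 6 * β * G.Lx := by
    rw [abs_mul, abs_of_nonneg (G.profile_nonneg h0 h1)]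
    exact (mul_le_of_le_one_left (abs_nonneg _) (G.profile_le_one h0 h1)).trans c
  have : 0 ≤ G.hmax ^ 2 * β * G.Lx := by positivity
  exact (abs_sub _ _).trans (by linarith)

lemma cumsum_slope (b : ℤ → ℝ) {i : ℤ} (h0 : 0 ≤ i) (h1 : i < G.Nx) :
    (G.cumsum b (i + 1) - G.cumsum b i) / G.hh i
      = G.hh i ^ 2 / 6 * b i - G.bump i * G.moment b := by
  have := (G.hh_pos h0 h1).ne'
  rw [cumsum, cumsum, sum_Ico_add_one h0, bump]
  field_simp
  ring

lemma abs_cumsum_slope_le {b : ℤ → ℝ} {β : ℝ} (hβ : 0 ≤ β)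
    (hb : ∀ l : ℤ, 0 ≤ l → l < G.Nx → |b l| ≤ β) {i : ℤ} (h0 : 0 ≤ i) (h1 : i < G.Nx) :
    |(G.cumsum b (i + 1) - G.cumsum b i) / G.hh i| ≤ 2 * β * G.hmax ^ 2 := by
  rw [G.cumsum_slope b h0 h1]
  have hL := G.Lx_pos
  have hp := G.hh_pos h0 h1
  have hm := G.hh_le_hmax h0 h1
  have a : |G.hh i ^ 2 / 6 * b i| ≤ G.hmax ^ 2 / 6 * β := by
    rw [abs_mul, abs_of_pos (by positivity)]
    have := hb i h0 h1
    gcongr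
  have c : |G.bump i * G.moment b| ≤ 6 / G.Lx * (G.hmax ^ 2 / 6 * β * G.Lx) := by
    rw [abs_mul]
    have := G.abs_bump_le h0 h1
    have := G.abs_moment_le hβ hb
    gcongr
  rw [show 6 / G.Lx * (G.hmax ^ 2 / 6 * β * G.Lx) = G.hmax ^ 2 * β by field_simp] at c
  have : 0 ≤ G.hmax ^ 2 * β := by positivity
  exact (abs_sub _ _).trans (by linarith)

lemma cumsum_sub_div (b c : ℤ → ℝ) (k : ℝ) (i : ℤ) :
    (G.cumsum b i - G.cumsum c i) / k = G.cumsum (fun l => (b l - c l) / k) i := by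
  have h : ∀ s : Finset ℤ, ∑ l ∈ s, G.hh l ^ 3 / 6 * ((b l - c l) / k)
      = (∑ l ∈ s, G.hh l ^ 3 / 6 * b l - ∑ l ∈ s, G.hh l ^ 3 / 6 * c l) / k := by
    intro s
    rw [← sum_sub_distrib, sum_div]
    exact sum_congr rfl fun _ _ => by ring
  simp only [cumsum, moment, h]
  ring

end Grid
end RMAC

namespace RMAC

/-! ### Jets of functions of two space variables -/

/-- `U b c` plays the role of `∂_x^b ∂_y^c U`. -/
structure Jet (U : ℕ → ℕ → ℝ → ℝ → ℝ) : Prop where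
  dx : ∀ b c x y, HasDerivAt (fun s => U b c s y) (U (b + 1) c x y) x
  dy : ∀ b c x y, HasDerivAt (fun s => U b c x s) (U b (c + 1) x y) y
  cont : ∀ b c, Continuous fun q : ℝ × ℝ => U b c q.1 q.2

/-- All derivatives of order at most four are bounded by `M` on `[0,Lx] × [0,Ly]`. -/
def JetBound (Lx Ly M : ℝ) (U : ℕ → ℕ → ℝ → ℝ → ℝ) : Prop :=
  ∀ b c : ℕ, b + c ≤ 4 → ∀ x ∈ Set.Icc 0 Lx, ∀ y ∈ Set.Icc 0 Ly, |U b c x y| ≤ M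

/-- Exchange of the two space variables in a jet. -/
def jswap (U : ℕ → ℕ → ℝ → ℝ → ℝ) : ℕ → ℕ → ℝ → ℝ → ℝ := fun b c x y => U c b y x

/-- The jet of the difference quotient of two functions. -/
def jquot (U U' : ℕ → ℕ → ℝ → ℝ → ℝ) (τ : ℝ) : ℕ → ℕ → ℝ → ℝ → ℝ :=
  fun b c x y => (U b c x y - U' b c x y) / τ

section

variable {U U' V : ℕ → ℕ → ℝ → ℝ → ℝ} {Lx Ly M : ℝ}

lemma Jet.swap (h : Jet U) : Jet (jswap U) where
  dx b c x y := h.dy c b y x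
  dy b c x y := h.dx c b y x
  cont b c := (h.cont c b).comp continuous_swap

lemma Jet.quot (h : Jet U) (h' : Jet U') (τ : ℝ) : Jet (jquot U U' τ) where
  dx b c x y := ((h.dx b c x y).sub (h'.dx b c x y)).div_const τ
  dy b c x y := ((h.dy b c x y).sub (h'.dy b c x y)).div_const τ
  cont b c := ((h.cont b c).sub (h'.cont b c)).div_const τ

lemma JetBound.swap (h : JetBound Lx Ly M U) : JetBound Ly Lx M (jswap U) :=
  fun b c hbc x hx y hy => h c b (by omega) y hy x hx

lemma Jet.seq_x (h : Jet U) (b c : ℕ) (y : ℝ) : DerivSeq fun k x => U (b + k) c x y :=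
  fun k x => h.dx (b + k) c x y

lemma Jet.seq_y (h : Jet U) (b c : ℕ) (x : ℝ) : DerivSeq fun k y => U b (c + k) x y :=
  fun k y => h.dy b (c + k) x y

lemma Jet.cont_x (h : Jet U) (b c : ℕ) (y : ℝ) : Continuous fun x => U b c x y :=
  (h.seq_x b c y).continuous 0

lemma Jet.cont_y (h : Jet U) (b c : ℕ) (x : ℝ) : Continuous fun y => U b c x y :=
  (h.seq_y b c x).continuous 0

end

lemma eq_zero_on_Icc {f : ℝ → ℝ} (hf : Continuous f) {a b : ℝ} (hab : a < b)
    (h : ∀ z ∈ Set.Ioo a b, f z = 0) : ∀ z ∈ Set.Icc a b, f z = 0 := by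
  have : Set.Icc a b ⊆ {z | f z = 0} := by
    rw [← closure_Ioo hab.ne]
    exact closure_minimal h (isClosed_eq hf continuous_const)
  exact this

/-- A divergence-free velocity field with zero boundary values and derivatives bounded by `M`. -/
structure Good (Lx Ly M : ℝ) (U V : ℕ → ℕ → ℝ → ℝ → ℝ) : Prop where
  jetU : Jet U
  jetV : Jet V
  boundU : JetBound Lx Ly M U
  boundV : JetBound Lx Ly M V
  div : ∀ x ∈ Set.Ioo 0 Lx, ∀ y ∈ Set.Ioo 0 Ly, U 1 0 x y + V 0 1 x y = 0
  zeroU : ∀ x ∈ Set.Icc 0 Lx, ∀ y ∈ Set.Icc 0 Ly, (x = 0 ∨ x = Lx ∨ y = 0 ∨ y = Ly) → U 0 0 x y = 0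
  zeroV : ∀ x ∈ Set.Icc 0 Lx, ∀ y ∈ Set.Icc 0 Ly, (x = 0 ∨ x = Lx ∨ y = 0 ∨ y = Ly) → V 0 0 x y = 0

namespace Good

variable {Lx Ly M : ℝ} {U V : ℕ → ℕ → ℝ → ℝ → ℝ}

lemma swap (h : Good Lx Ly M U V) : Good Ly Lx M (jswap V) (jswap U) where
  jetU := h.jetV.swap
  jetV := h.jetU.swap
  boundU := h.boundV.swap
  boundV := h.boundU.swap
  div x hx y hy := by rw [add_comm]; exact h.div y hy x hx
  zeroU x hx y hy hb := h.zeroV y hy x hx (by tauto)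
  zeroV x hx y hy hb := h.zeroU y hy x hx (by tauto)

lemma div_closed (h : Good Lx Ly M U V) (hx : 0 < Lx) (hy : 0 < Ly) :
    ∀ x ∈ Set.Icc 0 Lx, ∀ y ∈ Set.Icc 0 Ly, U 1 0 x y + V 0 1 x y = 0 := by
  intro x hx' y hy'
  refine eq_zero_on_Icc ((h.jetU.cont_x 1 0 y).add (h.jetV.cont_x 0 1 y)) hx (fun x hx => ?_) x hx'
  exact eq_zero_on_Icc ((h.jetU.cont_y 1 0 x).add (h.jetV.cont_y 0 1 x)) hy
    (fun y hy => h.div x hx y hy) y hy'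

/-- Wall-parallel derivatives of the velocity component vanish on the walls `x = 0`, `x = Lx`. -/
lemma U02_eq_zero (h : Good Lx Ly M U V) {x y : ℝ} (hx : x = 0 ∨ x = Lx) (hL : 0 ≤ Lx)
    (hy : y ∈ Set.Ioo 0 Ly) : U 0 2 x y = 0 := by
  have hx' : x ∈ Set.Icc 0 Lx := by rcases hx with rfl | rfl <;> simp [hL]
  have h0 : ∀ z ∈ Set.Ioo 0 Ly, U 0 0 x z = 0 := fun z hz =>
    h.zeroU x hx' z (Set.Ioo_subset_Icc_self hz) (by tauto)
  have h1 := (h.jetU.seq_y 0 0 x).eq_zero_of_eq_zero (k := 0) h0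
  exact (h.jetU.seq_y 0 0 x).eq_zero_of_eq_zero (k := 1) h1 y hy

/-- The divergence constraint makes `∂_x² ∂_y V` vanish on the walls `y = 0`, `y = Ly`. -/
lemma V21_eq_zero (h : Good Lx Ly M U V) {x y : ℝ} (hy : y = 0 ∨ y = Ly) (hLx : 0 < Lx)
    (hLy : 0 < Ly) (hx : x ∈ Set.Ioo 0 Lx) : V 2 1 x y = 0 := by
  have hy' : y ∈ Set.Icc 0 Ly := by rcases hy with rfl | rfl <;> simp [hLy.le]
  have h0 : ∀ z ∈ Set.Ioo 0 Lx, U 0 0 z y = 0 := fun z hz =>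
    h.zeroU z (Set.Ioo_subset_Icc_self hz) y hy' (by tauto)
  have h1 := (h.jetU.seq_x 0 0 y).eq_zero_of_eq_zero (k := 0) h0
  have h2 : ∀ z ∈ Set.Ioo 0 Lx, V 0 1 z y = 0 := fun z hz => by
    have := h.div_closed hLx hLy z (Set.Ioo_subset_Icc_self hz) y hy'
    have h1 := h1 z hz
    simp only [zero_add] at h1
    linarith
  have h3 := (h.jetV.seq_x 0 1 y).eq_zero_of_eq_zero (k := 0) h2
  exact (h.jetV.seq_x 0 1 y).eq_zero_of_eq_zero (k := 1) h3 x hx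

/-- The flux of the field through the boundary of a rectangle vanishes. -/
lemma flux_eq_zero (h : Good Lx Ly M U V) {a b c d : ℝ} (hab : a ≤ b) (hcd : c ≤ d)
    (hx : Set.Icc a b ⊆ Set.Icc 0 Lx) (hy : Set.Icc c d ⊆ Set.Icc 0 Ly) (hLx : 0 < Lx)
    (hLy : 0 < Ly) :
    (∫ y in c..d, U 0 0 b y) - (∫ y in c..d, U 0 0 a y)
      + ((∫ x in a..b, V 0 0 x d) - ∫ x in a..b, V 0 0 x c) = 0 := by
  rw [← intervalIntegral.integral_sub ((h.jetU.cont_y 0 0 b).intervalIntegrable _ _)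
      ((h.jetU.cont_y 0 0 a).intervalIntegrable _ _),
    ← intervalIntegral.integral_sub ((h.jetV.cont_x 0 0 d).intervalIntegrable _ _)
      ((h.jetV.cont_x 0 0 c).intervalIntegrable _ _)]
  have e1 : ∀ y, U 0 0 b y - U 0 0 a y = ∫ x in a..b, U 1 0 x y := fun y =>
    (intervalIntegral.integral_eq_sub_of_hasDerivAt (fun x _ => h.jetU.dx 0 0 x y)
      ((h.jetU.cont_x 1 0 y).intervalIntegrable _ _)).symm
  have e2 : ∀ x, V 0 0 x d - V 0 0 x c = ∫ y in c..d, V 0 1 x y := fun x =>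
    (intervalIntegral.integral_eq_sub_of_hasDerivAt (fun y _ => h.jetV.dy 0 0 x y)
      ((h.jetV.cont_y 0 1 x).intervalIntegrable _ _)).symm
  simp only [e1, e2]
  have e3 : (∫ x in a..b, ∫ y in c..d, V 0 1 x y) = ∫ x in a..b, ∫ y in c..d, -U 1 0 x y := by
    refine intervalIntegral.integral_congr fun x hx' => ?_
    refine intervalIntegral.integral_congr fun y hy' => ?_
    rw [Set.uIcc_of_le hab] at hx'
    rw [Set.uIcc_of_le hcd] at hy'
    have := h.div_closed hLx hLy x (hx hx') y (hy hy')
    show V 0 1 x y = -U 1 0 x y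
    linarith
  rw [e3, intervalIntegral_intervalIntegral_swap (F := fun x y => -U 1 0 x y)]
  · simp only [intervalIntegral.integral_neg]; ring
  · refine IntegrableOn.mono_set ?_ (Set.prod_mono Set.uIoc_subset_uIcc Set.uIoc_subset_uIcc)
    exact (h.jetU.cont 1 0).neg.continuousOn.integrableOn_compact
      (isCompact_uIcc.prod isCompact_uIcc)

end Good
end RMAC

namespace RMAC
namespace Grid
variable (G : Grid)

/-! ### A discretely divergence-free interpolant -/

/-- The interpolant `ŵ^x` at the x-edge points, away from the ghost indices: the mean of `U` over
the edge, corrected by the discrete curl of a nodal stream function of second order. -/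
def edgeInterp (U V : ℕ → ℕ → ℝ → ℝ → ℝ) (i j : ℤ) : ℝ :=
  1 / G.kk j * (∫ y in (G.yp j)..(G.yp (j + 1)), U 0 0 (G.xp i) y)
    - (G.swap.cumsum (fun l => U 0 2 (G.xp i) (G.yh l)) (j + 1)
        - G.swap.cumsum (fun l => U 0 2 (G.xp i) (G.yh l)) j) / G.kk j
    + (G.cumsum (fun l => V 2 0 (G.xh l) (G.yp (j + 1))) i
        - G.cumsum (fun l => V 2 0 (G.xh l) (G.yp j)) i) / G.kk j

/-- The interpolant `ŵ^x`, extended by zero to the ghost indices. -/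
def interp (U V : ℕ → ℕ → ℝ → ℝ → ℝ) (i j : ℤ) : ℝ :=
  if j = -1 ∨ j = G.Ny then 0 else G.edgeInterp U V i j

variable {G}
variable {U V U' V' : ℕ → ℕ → ℝ → ℝ → ℝ} {M : ℝ}

lemma interp_eq {i j : ℤ} (h0 : 0 ≤ j) (h1 : j < G.Ny) :
    G.interp U V i j = G.edgeInterp U V i j := by
  rw [interp, if_neg (by omega)]

lemma nonneg_of_jetBound (hU : JetBound G.Lx G.Ly M U) : 0 ≤ M :=
  (abs_nonneg _).trans (hU 0 0 (by omega) 0 ⟨le_rfl, G.Lx_pos.le⟩ 0 ⟨le_rfl, G.Ly_pos.le⟩)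

lemma yp_mem {j : ℤ} (h0 : 0 ≤ j) (h1 : j ≤ G.Ny) : G.yp j ∈ Set.Icc 0 G.Ly :=
  G.swap.xp_mem h0 h1

lemma yh_mem {j : ℤ} (h0 : 0 ≤ j) (h1 : j < G.Ny) : G.yh j ∈ Set.Icc 0 G.Ly :=
  G.swap.xh_mem h0 h1

lemma cell_y_subset {j : ℤ} (h0 : 0 ≤ j) (h1 : j < G.Ny) :
    Set.Icc (G.yp j) (G.yp (j + 1)) ⊆ Set.Icc 0 G.Ly :=
  G.swap.Icc_xp_subset h0 (k := j + 1) (by show j + 1 ≤ (G.Ny : ℤ); omega) (by omega)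

lemma cell_x_subset {i : ℤ} (h0 : 0 ≤ i) (h1 : i < G.Nx) :
    Set.Icc (G.xp i) (G.xp (i + 1)) ⊆ Set.Icc 0 G.Lx :=
  G.Icc_xp_subset h0 (by omega) (by omega)

lemma abs_slopeV_le (hV : Jet V) (bV : JetBound G.Lx G.Ly M V) {j : ℤ} (h0 : 0 ≤ j)
    (h1 : j < G.Ny) {l : ℤ} (l0 : 0 ≤ l) (l1 : l < G.Nx) :
    |(V 2 0 (G.xh l) (G.yp (j + 1)) - V 2 0 (G.xh l) (G.yp j)) / G.kk j| ≤ M :=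
  (hV.seq_y 2 0 (G.xh l)).slope_le (G.yp_mono j h0 h1) fun z hz =>
    bV 2 1 (by omega) _ (G.xh_mem l0 l1) z (cell_y_subset h0 h1 hz)

lemma interp_sub_le (hU : Jet U) (hV : Jet V) (bU : JetBound G.Lx G.Ly M U)
    (bV : JetBound G.Lx G.Ly M V) {i j : ℤ} (i0 : 0 ≤ i) (i1 : i ≤ G.Nx) (j0 : 0 ≤ j)
    (j1 : j < G.Ny) :
    |G.interp U V i j - U 0 0 (G.xp i) (G.yh j)|
      ≤ (3 + G.Lx) * M * (G.hmax ^ 2 + G.kmax ^ 2) := by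
  have hM := nonneg_of_jetBound bU
  have hL := G.Lx_pos
  have hk := G.swap.hh_pos j0 j1
  have hk' := G.swap.hh_le_hmax j0 j1
  rw [interp_eq j0 j1, edgeInterp, cumsum_sub_div]
  have a := (hU.seq_y 0 0 (G.xp i)).avg_sub_mid_le (M := M) (G.yp_mono j j0 j1) fun z hz =>
    bU 0 2 (by omega) _ (G.xp_mem i0 i1) z (cell_y_subset j0 j1 hz)
  have b := G.swap.abs_cumsum_slope_le hM (b := fun l => U 0 2 (G.xp i) (G.yh l)) (fun l l0 l1 =>
    bU 0 2 (by omega) _ (G.xp_mem i0 i1) _ (yh_mem l0 l1)) j0 j1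
  have c := G.abs_cumsum_le hM (fun l l0 l1 => abs_slopeV_le hV bV j0 j1 l0 l1) i0 i1
  have d : M * G.kk j ^ 2 ≤ M * G.kmax ^ 2 :=
    mul_le_mul_of_nonneg_left (pow_le_pow_left₀ hk.le hk' 2) hM
  have e : G.swap.hmax = G.kmax := rfl
  have e' : G.swap.hh j = G.kk j := rfl
  rw [e, e'] at b
  change |1 / G.kk j * _ - U 0 0 (G.xp i) (G.yh j)| ≤ M * G.kk j ^ 2 at a
  rw [abs_le] at *
  have f1 := mul_nonneg hM (sq_nonneg G.hmax)
  have f2 := mul_nonneg (mul_nonneg hL.le hM) (sq_nonneg G.kmax)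
  simp only [add_zero] at a
  constructor <;> linarith [a.1, a.2, b.1, b.2, c.1, c.2]

lemma interp_boundary (h : Good G.Lx G.Ly M U V) {j : ℤ} (j0 : 0 ≤ j) (j1 : j < G.Ny) :
    G.interp U V 0 j = 0 ∧ G.interp U V G.Nx j = 0 := by
  have key : ∀ i : ℤ, (i = 0 ∨ i = G.Nx) → G.interp U V i j = 0 := by
    intro i hi
    have hx : G.xp i = 0 ∨ G.xp i = G.Lx := by
      rcases hi with rfl | rfl
      · exact Or.inl G.xp_zero
      · exact Or.inr G.xp_last
    have hx' : G.xp i ∈ Set.Icc 0 G.Lx := by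
      rcases hx with e | e <;> rw [e] <;> simp [G.Lx_pos.le]
    have hc : ∀ b, G.cumsum b i = 0 := by
      intro b
      rcases hi with rfl | rfl
      · exact G.cumsum_zero b
      · exact G.cumsum_last b
    have hI : (∫ y in (G.yp j)..(G.yp (j + 1)), U 0 0 (G.xp i) y) = 0 := by
      rw [intervalIntegral.integral_congr (g := fun _ => (0 : ℝ))]
      · simp
      · intro y hy
        rw [Set.uIcc_of_le (G.yp_mono j j0 j1).le] at hy
        exact h.zeroU _ hx' y (cell_y_subset j0 j1 hy) (by tauto)
    have hz : ∀ l : ℤ, 0 ≤ l → l < G.Ny → U 0 2 (G.xp i) (G.yh l) = 0 := fun l l0 l1 =>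
      h.U02_eq_zero hx G.Lx_pos.le (G.swap.xh_mem_Ioo l0 l1)
    have hs : G.swap.hh j ^ 2 / 6 * U 0 2 (G.xp i) (G.yh j) = 0 := by
      rw [hz j j0 j1, mul_zero]
    have hm : G.swap.moment (fun l => U 0 2 (G.xp i) (G.yh l)) = 0 := by
      refine sum_eq_zero fun l hl => ?_
      rw [mem_Ico] at hl
      show _ * U 0 2 (G.xp i) (G.yh l) = 0
      rw [hz l hl.1 hl.2, mul_zero]
    have := G.swap.cumsum_slope (fun l => U 0 2 (G.xp i) (G.yh l)) j0 j1
    change _ / G.kk j = _ at this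
    rw [interp_eq j0 j1, edgeInterp, hI, hc, hc, this, hs, hm]
    simp
  exact ⟨key 0 (Or.inl rfl), key _ (Or.inr rfl)⟩

lemma dxEx_interp_sub_le (hU : Jet U) (hV : Jet V) (bU : JetBound G.Lx G.Ly M U)
    (bV : JetBound G.Lx G.Ly M V) {i j : ℤ} (i0 : 0 ≤ i) (i1 : i < G.Nx) (j0 : 0 ≤ j)
    (j1 : j < G.Ny) :
    |G.dxEx (G.interp U V) i j - U 1 0 (G.xh i) (G.yh j)|
      ≤ 3 * M * (G.hmax ^ 2 + G.kmax ^ 2) := by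
  have hM := nonneg_of_jetBound bU
  have hk := G.swap.hh_pos j0 j1
  have hk' := G.swap.hh_le_hmax j0 j1
  have hh := G.hh_pos i0 i1
  have hh' := G.hh_le_hmax i0 i1
  have hslope : ∀ c : ℕ, c ≤ 2 → ∀ y ∈ Set.Icc 0 G.Ly,
      |(U 0 c (G.xp (i + 1)) y - U 0 c (G.xp i) y) / G.hh i| ≤ M := fun c hc y hy =>
    (hU.seq_x 0 c y).slope_le (G.xp_mono i i0 i1) fun z hz =>
      bU 1 c (by omega) z (cell_x_subset i0 i1 hz) y hy
  have a := (((hU.seq_y 0 0 (G.xp (i + 1))).sub (hU.seq_y 0 0 (G.xp i))).div_const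
    (G.hh i)).avg_sub_mid_le (M := M) (G.yp_mono j j0 j1) fun z hz =>
      hslope 2 le_rfl z (cell_y_subset j0 j1 hz)
  have a' := (hU.seq_x 0 0 (G.yh j)).slope_sub_mid_le (M := M) (G.xp_mono i i0 i1) fun z hz =>
    bU 3 0 (by omega) z (cell_x_subset i0 i1 hz) _ (yh_mem j0 j1)
  have b := G.swap.abs_cumsum_slope_le hM
    (b := fun l => (U 0 2 (G.xp (i + 1)) (G.yh l) - U 0 2 (G.xp i) (G.yh l)) / G.hh i)
    (fun l l0 l1 => hslope 2 le_rfl _ (yh_mem l0 l1)) j0 j1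
  have c := G.abs_cumsum_slope_le hM (fun l l0 l1 => abs_slopeV_le hV bV j0 j1 l0 l1) i0 i1
  have key : G.dxEx (G.interp U V) i j
      = 1 / G.kk j * (∫ y in (G.yp j)..(G.yp (j + 1)),
            (U 0 0 (G.xp (i + 1)) y - U 0 0 (G.xp i) y) / G.hh i)
        - (G.swap.cumsum (fun l => (U 0 2 (G.xp (i + 1)) (G.yh l) - U 0 2 (G.xp i) (G.yh l))
              / G.hh i) (j + 1)
            - G.swap.cumsum (fun l => (U 0 2 (G.xp (i + 1)) (G.yh l) - U 0 2 (G.xp i) (G.yh l))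
              / G.hh i) j) / G.kk j
        + (G.cumsum (fun l => (V 2 0 (G.xh l) (G.yp (j + 1)) - V 2 0 (G.xh l) (G.yp j)) / G.kk j)
              (i + 1)
            - G.cumsum (fun l => (V 2 0 (G.xh l) (G.yp (j + 1)) - V 2 0 (G.xh l) (G.yp j))
              / G.kk j) i) / G.hh i := by
    rw [intervalIntegral.integral_div,
      intervalIntegral.integral_sub ((hU.cont_y 0 0 _).intervalIntegrable _ _)
        ((hU.cont_y 0 0 _).intervalIntegrable _ _), dxEx, interp_eq j0 j1, interp_eq j0 j1,
      edgeInterp, edgeInterp]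
    simp only [← cumsum_sub_div]
    have hk0 : G.kk j ≠ 0 := hk.ne'
    have hh0 : G.hh i ≠ 0 := hh.ne'
    field_simp
    ring
  rw [key]
  have d : M * G.kk j ^ 2 ≤ M * G.kmax ^ 2 :=
    mul_le_mul_of_nonneg_left (pow_le_pow_left₀ hk.le hk' 2) hM
  have d' : M * G.hh i ^ 2 ≤ M * G.hmax ^ 2 :=
    mul_le_mul_of_nonneg_left (pow_le_pow_left₀ hh.le hh' 2) hM
  have e : G.swap.hmax = G.kmax := rfl
  have e' : G.swap.hh j = G.kk j := rfl
  rw [e, e'] at b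
  simp only [add_zero, zero_add] at a a'
  change |1 / G.kk j * _ - (U 0 0 (G.xp (i + 1)) (G.yh j) - U 0 0 (G.xp i) (G.yh j)) / G.hh i|
    ≤ M * G.kk j ^ 2 at a
  change |(U 0 0 (G.xp (i + 1)) (G.yh j) - U 0 0 (G.xp i) (G.yh j)) / G.hh i
    - U 1 0 (G.xh i) (G.yh j)| ≤ M * G.hh i ^ 2 at a'
  rw [abs_le] at *
  constructor <;> linarith [a.1, a.2, b.1, b.2, c.1, c.2, a'.1, a'.2]

end Grid
end RMAC

namespace RMAC
namespace Grid
variable {G : Grid}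
variable {U V U' V' : ℕ → ℕ → ℝ → ℝ → ℝ} {M : ℝ}

/-- The difference quotient, on the dual mesh, of corrected edge means approximates the
derivative to second order, also next to a boundary with zero values. -/
lemma corrected_mean_dual_quotient_le {F : ℕ → ℝ → ℝ} (hF : DerivSeq F)
    (bF : ∀ z ∈ Set.Icc 0 G.Lx, |F 3 z| ≤ M) (h0 : F 0 0 = 0) (hL : F 0 G.Lx = 0)
    {g : ℤ → ℝ} (hg : ∀ i, g i = 1 / G.hh i * (∫ z in (G.xp i)..(G.xp (i + 1)), F 0 z)
      - G.hh i ^ 2 / 6 * F 2 (G.xh i)) {i : ℤ} (i0 : 0 ≤ i) (i1 : i ≤ G.Nx) :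
    |((if i = -1 ∨ i = G.Nx then 0 else g i)
      - (if i - 1 = -1 ∨ i - 1 = G.Nx then 0 else g (i - 1))) / G.hc i - F 1 (G.xp i)|
      ≤ 4 * M * G.hmax ^ 2 := by
  have hN := G.one_le_Nx
  have hM : 0 ≤ M := (abs_nonneg _).trans (bF 0 ⟨le_rfl, G.Lx_pos.le⟩)
  have cube : ∀ l : ℤ, 0 ≤ l → l < G.Nx →
      2 * M * |G.hh l| ^ 3 ≤ 4 * M * G.hmax ^ 2 * (G.hh l / 2) := by
    intro l l0 l1
    have p := G.hh_pos l0 l1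
    have q := pow_le_pow_left₀ p.le (G.hh_le_hmax l0 l1) 2
    rw [abs_of_pos p]
    nlinarith [mul_le_mul_of_nonneg_left q (mul_nonneg hM p.le)]
  have right : ∀ l : ℤ, 0 ≤ l → l < G.Nx →
      |g l - F 0 (G.xp l) - G.hh l / 2 * F 1 (G.xp l)| ≤ 4 * M * G.hmax ^ 2 * (G.hh l / 2) := by
    intro l l0 l1
    have p := G.hh_pos l0 l1
    have e : G.xp l + G.hh l = G.xp (l + 1) := by unfold hh; ring
    have e' : G.xp l + G.hh l / 2 = G.xh l := by unfold hh xh; ring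
    have := hF.corrected_avg_le (M := M) (x := G.xp l) p.ne' (by
      rw [e, Set.uIcc_of_le (G.xp_mono l l0 l1).le]
      exact fun z hz => bF z (cell_x_subset l0 l1 hz))
    rw [e, e', ← hg] at this
    exact this.trans (cube l l0 l1)
  have left : ∀ l : ℤ, 0 ≤ l → l < G.Nx →
      |g l - F 0 (G.xp (l + 1)) + G.hh l / 2 * F 1 (G.xp (l + 1))|
        ≤ 4 * M * G.hmax ^ 2 * (G.hh l / 2) := by
    intro l l0 l1
    have p := G.hh_pos l0 l1
    have e : G.xp (l + 1) + -G.hh l = G.xp l := by unfold hh; ring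
    have e' : G.xp (l + 1) + -G.hh l / 2 = G.xh l := by unfold hh xh; ring
    have := hF.corrected_avg_le (M := M) (x := G.xp (l + 1)) (neg_ne_zero.mpr p.ne') (by
      rw [e, Set.uIcc_of_ge (G.xp_mono l l0 l1).le]
      exact fun z hz => bF z (cell_x_subset l0 l1 hz))
    rw [e, e', intervalIntegral.integral_symm, neg_sq, abs_neg] at this
    refine le_trans (le_of_eq ?_) (this.trans (cube l l0 l1))
    rw [hg]
    congr 1
    rw [one_div_neg_eq_neg_one_div]
    ring
  have finish : ∀ a : ℝ, |a - G.hc i * F 1 (G.xp i)| ≤ 4 * M * G.hmax ^ 2 * G.hc i →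
      |a / G.hc i - F 1 (G.xp i)| ≤ 4 * M * G.hmax ^ 2 := by
    intro a ha
    have p := G.hc_pos i0 i1
    have e : a / G.hc i - F 1 (G.xp i) = (a - G.hc i * F 1 (G.xp i)) / G.hc i := by
      field_simp
    rw [e, abs_div, abs_of_pos p, div_le_iff₀ p]
    exact ha
  apply finish
  rcases i0.eq_or_lt with rfl | i0
  · rw [if_neg (by omega), if_pos (by omega), hc_zero]
    have := right 0 le_rfl (by omega)
    rw [G.xp_zero, h0] at this
    rw [G.xp_zero]
    simpa using this
  rcases i1.eq_or_lt with rfl | i1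
  · rw [if_pos (by omega), if_neg (by omega), hc_last]
    have := left (G.Nx - 1) (by omega) (by omega)
    rw [sub_add_cancel, G.xp_last, hL] at this
    rw [G.xp_last, ← abs_neg]
    refine le_trans (le_of_eq ?_) this
    congr 1
    ring
  · rw [if_neg (by omega), if_neg (by omega)]
    have a := right i i0.le i1
    have b := left (i - 1) (by omega) (by omega)
    rw [sub_add_cancel] at b
    have e : G.hc i = G.hh (i - 1) / 2 + G.hh i / 2 := by
      rw [hc, if_neg (by omega), if_neg (by omega)]; ring
    rw [e]
    rw [abs_le] at *
    constructor <;> linarith [a.1, a.2, b.1, b.2]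

lemma tangential_quotient_le (h : Good G.Lx G.Ly M U V) {i j : ℤ} (i0 : 0 ≤ i) (i1 : i ≤ G.Nx)
    (j0 : 0 ≤ j) (j1 : j ≤ G.Ny) {f : ℤ → ℝ}
    (hf : ∀ j, f j = G.cumsum (fun l => (V 2 0 (G.xh l) (G.yp (j + 1)) - V 2 0 (G.xh l) (G.yp j))
      / G.kk j) i) :
    |((if j = -1 ∨ j = G.Ny then 0 else f j)
      - (if j - 1 = -1 ∨ j - 1 = G.Ny then 0 else f (j - 1))) / G.kc j|
      ≤ 2 * (G.Lx * M * G.hmax ^ 2) := by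
  have hM := nonneg_of_jetBound h.boundU
  have hN := G.one_le_Ny
  have left : ∀ l j : ℤ, 0 ≤ l → l < G.Nx → 0 ≤ j → j < G.Ny →
      |(V 2 0 (G.xh l) (G.yp (j + 1)) - V 2 0 (G.xh l) (G.yp j)) / G.kk j
        - V 2 1 (G.xh l) (G.yp j)| ≤ M * G.kk j := fun l j l0 l1 j0 j1 =>
    (h.jetV.seq_y 2 0 (G.xh l)).slope_sub_left_le (G.yp_mono j j0 j1) fun z hz =>
      h.boundV 2 2 (by omega) _ (G.xh_mem l0 l1) z (cell_y_subset j0 j1 hz)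
  have right : ∀ l j : ℤ, 0 ≤ l → l < G.Nx → 0 ≤ j → j < G.Ny →
      |(V 2 0 (G.xh l) (G.yp (j + 1)) - V 2 0 (G.xh l) (G.yp j)) / G.kk j
        - V 2 1 (G.xh l) (G.yp (j + 1))| ≤ M * G.kk j := fun l j l0 l1 j0 j1 =>
    (h.jetV.seq_y 2 0 (G.xh l)).slope_sub_right_le (G.yp_mono j j0 j1) fun z hz =>
      h.boundV 2 2 (by omega) _ (G.xh_mem l0 l1) z (cell_y_subset j0 j1 hz)
  refine G.swap.dual_quotient_le ?_ ?_ ?_ j0 j1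
  · have p := G.swap.hh_pos (i := 0) le_rfl (by show (0:ℤ) < G.Ny; omega)
    have := G.abs_cumsum_le (mul_nonneg hM p.le) (b := fun l =>
      (V 2 0 (G.xh l) (G.yp (0 + 1)) - V 2 0 (G.xh l) (G.yp 0)) / G.kk 0) (fun l l0 l1 => by
        have := left l 0 l0 l1 le_rfl (by omega)
        rwa [h.V21_eq_zero (Or.inl G.yp_zero) G.Lx_pos G.Ly_pos (G.xh_mem_Ioo l0 l1),
          sub_zero] at this) i0 i1
    rw [hf]
    refine this.trans (le_of_eq ?_)
    ring
  · have p := G.swap.hh_pos (i := G.Ny - 1) (by omega) (by show (G.Ny - 1:ℤ) < G.Ny; omega)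
    have := G.abs_cumsum_le (mul_nonneg hM p.le) (b := fun l =>
      (V 2 0 (G.xh l) (G.yp (G.Ny - 1 + 1)) - V 2 0 (G.xh l) (G.yp (G.Ny - 1)))
        / G.kk (G.Ny - 1)) (fun l l0 l1 => by
        have := right l (G.Ny - 1) l0 l1 (by omega) (by omega)
        rwa [h.V21_eq_zero (y := G.yp (G.Ny - 1 + 1))
          (Or.inr (by rw [sub_add_cancel, G.yp_last])) G.Lx_pos G.Ly_pos (G.xh_mem_Ioo l0 l1),
          sub_zero] at this) i0 i1
    show |f (G.Ny - 1)| ≤ _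
    rw [hf]
    refine this.trans (le_of_eq ?_)
    show _ = 2 * (G.Lx * M * G.hmax ^ 2) * (G.swap.hh (G.Ny - 1) / 2)
    ring
  · intro j j0 j1
    change j < G.Ny at j1
    have p := G.swap.hh_pos j0.le j1
    have p' := G.swap.hh_pos (i := j - 1) (by omega) (by show j - 1 < (G.Ny : ℤ); omega)
    have := G.abs_cumsum_le (mul_nonneg hM (add_nonneg p.le p'.le)) (b := fun l =>
      ((V 2 0 (G.xh l) (G.yp (j + 1)) - V 2 0 (G.xh l) (G.yp j)) / G.kk j
        - (V 2 0 (G.xh l) (G.yp (j - 1 + 1)) - V 2 0 (G.xh l) (G.yp (j - 1))) / G.kk (j - 1)) / 1)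
      (fun l l0 l1 => by
        have a := left l j l0 l1 j0.le j1
        have b := right l (j - 1) l0 l1 (by omega) (by omega)
        have e : V 2 1 (G.xh l) (G.yp (j - 1 + 1)) = V 2 1 (G.xh l) (G.yp j) := by
          rw [sub_add_cancel]
        rw [e] at b
        rw [div_one]
        change |_| ≤ M * (G.kk j + G.kk (j - 1))
        rw [abs_le] at *
        constructor <;> linarith [a.1, a.2, b.1, b.2]) i0 i1
    rw [← cumsum_sub_div, div_one, ← hf, ← hf] at this
    refine this.trans (le_of_eq ?_)
    have e : G.swap.hh j + G.swap.hh (j - 1) = G.swap.xp (j + 1) - G.swap.xp (j - 1) := by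
      unfold hh; rw [sub_add_cancel]; ring
    rw [e]
    ring

lemma DyEx_interp_sub_le (h : Good G.Lx G.Ly M U V) {i j : ℤ} (i0 : 0 ≤ i) (i1 : i ≤ G.Nx)
    (j0 : 0 ≤ j) (j1 : j ≤ G.Ny) :
    |G.DyEx (G.interp U V) i j - U 0 1 (G.xp i) (G.yp j)|
      ≤ (4 + 2 * G.Lx + 1 / G.Ly) * M * (G.hmax ^ 2 + G.kmax ^ 2) := by
  have hM := nonneg_of_jetBound h.boundU
  have hLx := G.Lx_pos
  have hLy := G.Ly_pos
  have hx := G.xp_mem i0 i1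
  set g : ℤ → ℝ := fun j => 1 / G.kk j * (∫ y in (G.yp j)..(G.yp (j + 1)), U 0 0 (G.xp i) y)
    - G.kk j ^ 2 / 6 * U 0 2 (G.xp i) (G.yh j) with hg
  set f : ℤ → ℝ := fun j => G.cumsum (fun l => (V 2 0 (G.xh l) (G.yp (j + 1))
    - V 2 0 (G.xh l) (G.yp j)) / G.kk j) i with hf
  set m := G.swap.moment (fun l => U 0 2 (G.xp i) (G.yh l)) with hm
  have a := corrected_mean_dual_quotient_le (G := G.swap) (h.jetU.seq_y 0 0 (G.xp i))
    (fun z hz => h.boundU 0 3 (by omega) _ hx z hz)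
    (h.zeroU _ hx 0 ⟨le_rfl, hLy.le⟩ (by tauto)) (h.zeroU _ hx _ ⟨hLy.le, le_rfl⟩ (by
      right; right; right; rfl)) (g := g) (fun j => rfl) j0 j1
  have b := G.swap.bump_dual_quotient_le j0 j1
  have c := tangential_quotient_le h i0 i1 j0 j1 (f := f) (fun j => rfl)
  have d := G.swap.abs_moment_le hM (b := fun l => U 0 2 (G.xp i) (G.yh l)) (fun l l0 l1 =>
    h.boundU 0 2 (by omega) _ hx _ (yh_mem l0 l1))
  rw [← hm] at d
  have key : ∀ l : ℤ, -1 ≤ l → l ≤ G.Ny → G.interp U V i l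
      = (if l = -1 ∨ l = G.Ny then 0 else g l) + (if l = -1 ∨ l = G.Ny then 0 else G.swap.bump l) * m
        + (if l = -1 ∨ l = G.Ny then 0 else f l) := by
    intro l l0 l1
    unfold interp
    by_cases hl : l = -1 ∨ l = (G.Ny : ℤ)
    · simp [hl]
    · have := G.swap.cumsum_slope (fun l => U 0 2 (G.xp i) (G.yh l)) (i := l) (by omega)
        (by show l < (G.Ny : ℤ); omega)
      change _ / G.kk l = G.kk l ^ 2 / 6 * _ - _ at this
      simp only [if_neg hl]
      rw [edgeInterp, this, cumsum_sub_div]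
      simp only [hg, hf, hm]
      ring
  rw [DyEx, key j (by omega) j1, key (j - 1) (by omega) (by omega)]
  change |_ / G.kc j - U 0 1 (G.xp i) (G.yp j)| ≤ 4 * M * G.kmax ^ 2 at a
  change |_ / G.kc j| ≤ 6 / G.Ly ^ 2 at b
  change |m| ≤ G.kmax ^ 2 / 6 * M * G.Ly at d
  have bd : |((if j = -1 ∨ j = G.Ny then 0 else G.swap.bump j)
      - (if j - 1 = -1 ∨ j - 1 = G.Ny then 0 else G.swap.bump (j - 1))) / G.kc j * m|
      ≤ 1 / G.Ly * M * G.kmax ^ 2 := by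
    rw [abs_mul]
    refine (mul_le_mul b d (abs_nonneg _) (by positivity)).trans (le_of_eq ?_)
    field_simp
  change |((if j = -1 ∨ j = (G.Ny : ℤ) then 0 else g j)
    - (if j - 1 = -1 ∨ j - 1 = (G.Ny : ℤ) then 0 else g (j - 1))) / G.kc j - _| ≤ _ at a
  have f1 := mul_nonneg hM (sq_nonneg G.hmax)
  have f2 := mul_nonneg (mul_nonneg hLx.le hM) (sq_nonneg G.kmax)
  have f3 : 0 ≤ 1 / G.Ly * M * G.hmax ^ 2 := by positivity
  rw [abs_le] at *
  have split : ∀ p p' q q' r r' : ℝ, (p + q * m + r - (p' + q' * m + r')) / G.kc j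
      = (p - p') / G.kc j + (q - q') / G.kc j * m + (r - r') / G.kc j := by intros; ring
  rw [split]
  constructor <;> linarith [a.1, a.2, bd.1, bd.2, c.1, c.2]

/-- The interpolant is exactly divergence-free in the discrete sense. -/
lemma div_interp (h : Good G.Lx G.Ly M U V) {i j : ℤ} (i0 : 0 ≤ i) (i1 : i < G.Nx)
    (j0 : 0 ≤ j) (j1 : j < G.Ny) :
    G.dxEx (G.interp U V) i j
      + G.dyEy (fun i j => G.swap.interp (jswap V) (jswap U) j i) i j = 0 := by
  have hk : G.kk j ≠ 0 := (G.swap.hh_pos j0 j1).ne'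
  have hh : G.hh i ≠ 0 := (G.hh_pos i0 i1).ne'
  have fl := h.flux_eq_zero (G.xp_mono i i0 i1).le (G.yp_mono j j0 j1).le (cell_x_subset i0 i1)
    (cell_y_subset j0 j1) G.Lx_pos G.Ly_pos
  have e : ∀ j, G.swap.interp (jswap V) (jswap U) j i
      = 1 / G.hh i * (∫ x in (G.xp i)..(G.xp (i + 1)), V 0 0 x (G.yp j))
        - (G.cumsum (fun l => V 2 0 (G.xh l) (G.yp j)) (i + 1)
            - G.cumsum (fun l => V 2 0 (G.xh l) (G.yp j)) i) / G.hh i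
        + (G.swap.cumsum (fun l => U 0 2 (G.xp (i + 1)) (G.yh l)) j
            - G.swap.cumsum (fun l => U 0 2 (G.xp i) (G.yh l)) j) / G.hh i := fun j =>
    interp_eq (G := G.swap) i0 i1
  rw [dxEx, dyEy, e, e, interp_eq j0 j1, interp_eq j0 j1, edgeInterp, edgeInterp]
  field_simp
  linear_combination fl

/-- The interpolant commutes with difference quotients in time. -/
lemma interp_quot (hU : Jet U) (hU' : Jet U') (τ : ℝ) (i j : ℤ) :
    (G.interp U V i j - G.interp U' V' i j) / τ
      = G.interp (jquot U U' τ) (jquot V V' τ) i j := by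
  unfold interp
  split_ifs with hj
  · simp
  · unfold edgeInterp jquot
    rw [intervalIntegral.integral_div,
      intervalIntegral.integral_sub ((hU.cont_y 0 0 _).intervalIntegrable _ _)
        ((hU'.cont_y 0 0 _).intervalIntegrable _ _)]
    simp only [← cumsum_sub_div]
    ring

end Grid
end RMAC

namespace RMAC

/-! ### Consistency of one time step -/

/-- Data of one time step: the velocity `(U, V)` at the new time, `(U', V')` at the old time, its
time derivative `(A, B)` and the pressure `P` at the new time, and the source. -/
structure StepData (Lx Ly μ Δt M : ℝ) (U V U' V' A B P : ℕ → ℕ → ℝ → ℝ → ℝ)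
    (gx gy : ℝ → ℝ → ℝ) : Prop where
  good : Good Lx Ly M U V
  good' : Good Lx Ly M U' V'
  quotU : JetBound Lx Ly M (jquot U U' Δt)
  quotV : JetBound Lx Ly M (jquot V V' Δt)
  jetA : Jet A
  jetB : Jet B
  boundA : JetBound Lx Ly M A
  boundB : JetBound Lx Ly M B
  jetP : Jet P
  timeU : ∀ x ∈ Set.Icc 0 Lx, ∀ y ∈ Set.Icc 0 Ly, |jquot U U' Δt 0 0 x y - A 0 0 x y| ≤ M * Δt
  timeV : ∀ x ∈ Set.Icc 0 Lx, ∀ y ∈ Set.Icc 0 Ly, |jquot V V' Δt 0 0 x y - B 0 0 x y| ≤ M * Δt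
  momx : ∀ x ∈ Set.Ioo 0 Lx, ∀ y ∈ Set.Ioo 0 Ly,
    A 0 0 x y - μ * (U 2 0 x y + U 0 2 x y) + P 1 0 x y = gx x y
  momy : ∀ x ∈ Set.Ioo 0 Lx, ∀ y ∈ Set.Ioo 0 Ly,
    B 0 0 x y - μ * (V 2 0 x y + V 0 2 x y) + P 0 1 x y = gy x y

lemma StepData.swap {Lx Ly μ Δt M : ℝ} {U V U' V' A B P : ℕ → ℕ → ℝ → ℝ → ℝ} {gx gy : ℝ → ℝ → ℝ}
    (d : StepData Lx Ly μ Δt M U V U' V' A B P gx gy) :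
    StepData Ly Lx μ Δt M (jswap V) (jswap U) (jswap V') (jswap U') (jswap B) (jswap A) (jswap P)
      (fun x y => gy y x) (fun x y => gx y x) where
  good := d.good.swap
  good' := d.good'.swap
  quotU := d.quotV.swap
  quotV := d.quotU.swap
  jetA := d.jetB.swap
  jetB := d.jetA.swap
  boundA := d.boundB.swap
  boundB := d.boundA.swap
  jetP := d.jetP.swap
  timeU x hx y hy := d.timeV y hy x hx
  timeV x hx y hy := d.timeU y hy x hx
  momx x hx y hy := by
    rw [← d.momy y hy x hx, add_comm (V 2 0 y x)]; rfl
  momy x hx y hy := by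
    rw [← d.momx y hy x hx, add_comm (U 2 0 y x)]; rfl

namespace Grid
variable (G : Grid)

/-- The cell-centered pressure with the second order corrections coming from the time
derivative of the velocity. -/
def pressInterp (A B P : ℕ → ℕ → ℝ → ℝ → ℝ) (i j : ℤ) : ℝ :=
  P 0 0 (G.xh i) (G.yh j) + (G.hh i ^ 2 / 8 * A 1 0 (G.xh i) (G.yh j)
    + G.kk j ^ 2 / 8 * B 0 1 (G.xh i) (G.yh j))

/-- The consistent normal stress at cell centers. -/
def stressInterp (U : ℕ → ℕ → ℝ → ℝ → ℝ) (i j : ℤ) : ℝ :=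
  U 1 0 (G.xh i) (G.yh j) + G.hh i ^ 2 / 8 * U 1 2 (G.xh i) (G.yh j)

/-- The residual of the interpolant in the first momentum equation. -/
def residual (μ Δt : ℝ) (U V U' V' A B P : ℕ → ℕ → ℝ → ℝ → ℝ) (gx : ℝ → ℝ → ℝ) (i j : ℤ) : ℝ :=
  1 / G.hc i * (∫ x in (G.xh (i - 1))..(G.xh i), gx x (G.yh j))
    - G.DxC (G.pressInterp A B P) i j
    - (G.interp U V i j - G.interp U' V' i j) / Δt
    + μ * G.DxC (G.stressInterp U) i j
    + μ * ((U 0 1 (G.xp i) (G.yp (j + 1)) - U 0 1 (G.xp i) (G.yp j)) / G.kk j)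

variable {G}
variable {μ Δt M : ℝ} {U V U' V' A B P : ℕ → ℕ → ℝ → ℝ → ℝ} {gx gy : ℝ → ℝ → ℝ}

/-- The mean over a dual cell against the corrected point value. -/
lemma dual_mean_sub_le {W : ℕ → ℕ → ℝ → ℝ → ℝ} (hW : Jet W) (bW : JetBound G.Lx G.Ly M W) {c : ℕ}
    (hc : c ≤ 2) {i j : ℤ} (i0 : 0 < i) (i1 : i < G.Nx) (j0 : 0 ≤ j) (j1 : j < G.Ny) :
    |1 / G.hc i * (∫ x in (G.xh (i - 1))..(G.xh i), W 0 c x (G.yh j)) - W 0 c (G.xp i) (G.yh j)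
      - G.DxC (fun i j => G.hh i ^ 2 / 8 * W 1 c (G.xh i) (G.yh j)) i j| ≤ M * G.hmax ^ 2 := by
  have l0 : 0 ≤ i - 1 := by omega
  have l1 : i - 1 < G.Nx := by omega
  have e : i - 1 + 1 = i := by ring
  have m := G.xp_mono (i - 1) l0 l1
  have m' := G.hh_le_hmax l0 l1
  rw [e] at m
  have q : G.hh (i - 1) = G.xp i - G.xp (i - 1) := by rw [hh, e]
  rw [q] at m'
  have a := (hW.seq_x 0 c (G.yh j)).dual_avg_le (M := M) (H := G.hmax) m (G.xp_mono i i0.le i1) m'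
    (G.hh_le_hmax i0.le i1) fun z hz => bW 2 c (by omega) z
      (G.Icc_xp_subset l0 (by omega) (by omega) hz) _ (yh_mem j0 j1)
  rw [← G.hc_eq i0 i1] at a
  simp only [add_zero, zero_add] at a
  rw [DxC, q, show G.xh (i - 1) = (G.xp (i - 1) + G.xp i) / 2 by rw [xh, e]]
  exact a

lemma xh_sub_xh {i : ℤ} (i0 : 0 < i) (i1 : i < G.Nx) : G.xh i - G.xh (i - 1) = G.hc i := by
  rw [G.hc_eq i0 i1, xh, xh, sub_add_cancel]; ring

lemma abs_residual_le (d : StepData G.Lx G.Ly μ Δt M U V U' V' A B P gx gy) (hμ : 0 ≤ μ)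
    {i j : ℤ} (i0 : 0 < i) (i1 : i < G.Nx) (j0 : 0 ≤ j) (j1 : j < G.Ny) :
    |G.residual μ Δt U V U' V' A B P gx i j|
      ≤ (4 + G.Lx) * M * (G.hmax ^ 2 + G.kmax ^ 2) + M * Δt
        + μ * (M * (G.hmax ^ 2 + G.kmax ^ 2)) := by
  have hM := nonneg_of_jetBound d.boundA
  have hc := G.hc_pos i0.le i1.le
  have hk := G.swap.hh_pos j0 j1
  have hk' := pow_le_pow_left₀ hk.le (G.swap.hh_le_hmax j0 j1) 2
  change G.kk j ^ 2 ≤ G.kmax ^ 2 at hk'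
  have l0 : 0 ≤ i - 1 := by omega
  have l1 : i - 1 < G.Nx := by omega
  have hy := yh_mem j0 j1
  have hx := G.xp_mem i0.le i1.le
  have hlt : G.xh (i - 1) < G.xh i := by linarith [xh_sub_xh i0 i1]
  have sub : Set.Icc (G.xh (i - 1)) (G.xh i) ⊆ Set.Ioo 0 G.Lx := fun z hz =>
    ⟨(G.xh_mem_Ioo l0 l1).1.trans_le hz.1, hz.2.trans_lt (G.xh_mem_Ioo i0.le i1).2⟩
  have source : (∫ x in (G.xh (i - 1))..(G.xh i), gx x (G.yh j))
      = (∫ x in (G.xh (i - 1))..(G.xh i), A 0 0 x (G.yh j))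
        - μ * ((U 1 0 (G.xh i) (G.yh j) - U 1 0 (G.xh (i - 1)) (G.yh j))
          + ∫ x in (G.xh (i - 1))..(G.xh i), U 0 2 x (G.yh j))
        + (P 0 0 (G.xh i) (G.yh j) - P 0 0 (G.xh (i - 1)) (G.yh j)) := by
    have e1 := intervalIntegral.integral_eq_sub_of_hasDerivAt (a := G.xh (i - 1)) (b := G.xh i)
      (fun x _ => d.good.jetU.dx 1 0 x (G.yh j))
      ((d.good.jetU.cont_x 2 0 (G.yh j)).intervalIntegrable _ _)
    have e2 := intervalIntegral.integral_eq_sub_of_hasDerivAt (a := G.xh (i - 1)) (b := G.xh i)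
      (fun x _ => d.jetP.dx 0 0 x (G.yh j))
      ((d.jetP.cont_x 1 0 (G.yh j)).intervalIntegrable _ _)
    have cA := d.jetA.cont_x 0 0 (G.yh j)
    have c2 := d.good.jetU.cont_x 2 0 (G.yh j)
    have c3 := d.good.jetU.cont_x 0 2 (G.yh j)
    have cP := d.jetP.cont_x 1 0 (G.yh j)
    have c4 : Continuous fun x => μ * (U 2 0 x (G.yh j) + U 0 2 x (G.yh j)) :=
      continuous_const.mul (c2.add c3)
    have c5 : Continuous fun x => A 0 0 x (G.yh j) - μ * (U 2 0 x (G.yh j) + U 0 2 x (G.yh j)) :=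
      cA.sub c4
    rw [← e1, ← e2, ← intervalIntegral.integral_add (c2.intervalIntegrable _ _)
      (c3.intervalIntegrable _ _), ← intervalIntegral.integral_const_mul,
      ← intervalIntegral.integral_sub (cA.intervalIntegrable _ _)
        (c4.intervalIntegrable _ _),
      ← intervalIntegral.integral_add (c5.intervalIntegrable _ _) (cP.intervalIntegrable _ _)]
    refine intervalIntegral.integral_congr fun x hx => ?_
    rw [Set.uIcc_of_le hlt.le] at hx
    exact (d.momx x (sub hx) _ (G.swap.xh_mem_Ioo j0 j1)).symm
  have a := dual_mean_sub_le d.jetA d.boundA (c := 0) (by omega) i0 i1 j0 j1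
  have b := dual_mean_sub_le d.good.jetU d.good.boundU (c := 2) le_rfl i0 i1 j0 j1
  have c := (d.good.jetU.seq_y 0 1 (G.xp i)).slope_sub_mid_le (M := M) (G.yp_mono j j0 j1)
    fun z hz => d.good.boundU 0 4 le_rfl _ hx z (cell_y_subset j0 j1 hz)
  have e := interp_sub_le (d.good.jetU.quot d.good'.jetU Δt) (d.good.jetV.quot d.good'.jetV Δt)
    d.quotU d.quotV i0.le i1.le j0 j1
  rw [← interp_quot d.good.jetU d.good'.jetU] at e
  have f := d.timeU _ hx _ hy
  have g : |G.kk j ^ 2 / 8 * ((B 0 1 (G.xh i) (G.yh j) - B 0 1 (G.xh (i - 1)) (G.yh j)) / G.hc i)|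
      ≤ M * G.kmax ^ 2 := by
    have := (d.jetB.seq_x 0 1 (G.yh j)).slope_le (M := M) hlt fun z hz =>
      d.boundB 1 1 (by omega) z (Set.Ioo_subset_Icc_self (sub hz)) _ hy
    rw [xh_sub_xh i0 i1] at this
    rw [abs_mul, abs_of_nonneg (by positivity), mul_comm M]
    refine mul_le_mul ?_ this (abs_nonneg _) (sq_nonneg _)
    linarith [sq_nonneg (G.kk j)]
  simp only [add_zero] at c
  change |(U 0 1 (G.xp i) (G.yp (j + 1)) - U 0 1 (G.xp i) (G.yp j)) / G.kk j
    - U 0 2 (G.xp i) (G.yh j)| ≤ M * G.kk j ^ 2 at c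
  have c' := c.trans (mul_le_mul_of_nonneg_left hk' hM)
  have key : G.residual μ Δt U V U' V' A B P gx i j
      = (1 / G.hc i * (∫ x in (G.xh (i - 1))..(G.xh i), A 0 0 x (G.yh j))
          - A 0 0 (G.xp i) (G.yh j)
          - G.DxC (fun i j => G.hh i ^ 2 / 8 * A 1 0 (G.xh i) (G.yh j)) i j)
        - (jquot U U' Δt 0 0 (G.xp i) (G.yh j) - A 0 0 (G.xp i) (G.yh j))
        - ((G.interp U V i j - G.interp U' V' i j) / Δt - jquot U U' Δt 0 0 (G.xp i) (G.yh j))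
        - G.kk j ^ 2 / 8 * ((B 0 1 (G.xh i) (G.yh j) - B 0 1 (G.xh (i - 1)) (G.yh j)) / G.hc i)
        + μ * ((U 0 1 (G.xp i) (G.yp (j + 1)) - U 0 1 (G.xp i) (G.yp j)) / G.kk j
              - U 0 2 (G.xp i) (G.yh j)
            - (1 / G.hc i * (∫ x in (G.xh (i - 1))..(G.xh i), U 0 2 x (G.yh j))
              - U 0 2 (G.xp i) (G.yh j)
              - G.DxC (fun i j => G.hh i ^ 2 / 8 * U 1 2 (G.xh i) (G.yh j)) i j)) := by
    rw [residual, source]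
    simp only [DxC, pressInterp, stressInterp]
    ring
  rw [key]
  have visc := mul_le_mul_of_nonneg_left
    ((abs_sub _ _).trans (add_le_add c' b)) hμ
  rw [← abs_of_nonneg hμ, ← abs_mul, abs_of_nonneg hμ] at visc
  have f1 := mul_nonneg hM (sq_nonneg G.hmax)
  rw [abs_le] at *
  constructor <;> linarith [a.1, a.2, e.1, e.2, f.1, f.2, g.1, g.2, visc.1, visc.2]

end Grid
end RMAC

namespace RMAC
namespace Grid
variable {G : Grid}
variable {μ Δt M K D : ℝ} {U V U' V' A B P : ℕ → ℕ → ℝ → ℝ → ℝ} {gx gy : ℝ → ℝ → ℝ}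

/-! ### Energy estimate for one time step -/

lemma component_step (d : StepData G.Lx G.Ly μ Δt M U V U' V' A B P gx gy) (hμ : 0 ≤ μ)
    (hΔt : 0 < Δt) (hK : 5 + 2 * G.Lx + 1 / G.Ly ≤ K) (hD : G.hmax ^ 2 + G.kmax ^ 2 + Δt ≤ D)
    {W W' Z : ℤ → ℤ → ℝ} (hx : ∀ j, W 0 j = 0 ∧ W G.Nx j = 0)
    (hy : ∀ i, W i (-1) = 0 ∧ W i G.Ny = 0)
    (heq : ∀ i ∈ Icc (1 : ℤ) ((G.Nx : ℤ) - 1), ∀ j ∈ Icc (0 : ℤ) ((G.Ny : ℤ) - 1),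
      (W i j - W' i j) / Δt
        - μ * ((G.dxEx W i j - G.dxEx W (i - 1) j) / G.hc i)
        - μ * ((G.DyEx W i (j + 1) - G.DyEx W i j) / G.kk j)
        + G.DxC Z i j = 1 / G.hc i * ∫ x in (G.xh (i - 1))..(G.xh i), gx x (G.yh j)) :
    G.ipTM (fun i j => W i j - G.interp U V i j) (fun i j => W i j - G.interp U V i j)
      ≤ G.ipTM (fun i j => W' i j - G.interp U' V' i j) (fun i j => W' i j - G.interp U' V' i j)
        + 2 * Δt * G.ipM (fun i j => Z i j - G.pressInterp A B P i j)
            (G.dxEx fun i j => W i j - G.interp U V i j)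
        + Δt * (G.ipTM (fun i j => W i j - G.interp U V i j) (fun i j => W i j - G.interp U V i j)
          + G.Lx * G.Ly * (K * M * (1 + μ) * D) ^ 2 + μ * (G.Lx * G.Ly * (K * M * D) ^ 2)) := by
  have hM := nonneg_of_jetBound d.boundA
  have hLx := G.Lx_pos
  have hLy := G.Ly_pos
  have hLy' : 0 < 1 / G.Ly := by positivity
  have hH : 0 ≤ G.hmax ^ 2 + G.kmax ^ 2 := by positivity
  have scale : ∀ c H : ℝ, c ≤ K → H ≤ D → 0 ≤ H → c * M * H ≤ K * M * D := by
    intro c H hc hHD h0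
    have : c * (M * H) ≤ K * (M * D) :=
      mul_le_mul hc (mul_le_mul_of_nonneg_left hHD hM) (by positivity) (by linarith)
    linarith
  refine G.energy_component hμ hΔt (E := fun i j => G.dxEx W i j - G.stressInterp U i j)
    (F := fun i j => G.DyEx W i j - U 0 1 (G.xp i) (G.yp j))
    (S := G.residual μ Δt U V U' V' A B P gx) ?_ ?_ ?_ ?_ ?_ ?_
  · intro j hj
    rw [mem_Icc] at hj
    have := interp_boundary d.good hj.1 (by omega)
    simp [this.1, this.2, hx j]
  · intro i _
    simp [interp, hy i]
  · intro i hi j hj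
    have := heq i hi j hj
    rw [residual, ← this]
    simp only [DxC]
    ring
  · intro i hi j hj
    rw [mem_Icc] at hi hj
    have a := dxEx_interp_sub_le d.good.jetU d.good.jetV d.good.boundU d.good.boundV hi.1
      (by omega) hj.1 (by omega)
    have hh := G.hh_pos hi.1 (by omega)
    have b : |G.hh i ^ 2 / 8 * U 1 2 (G.xh i) (G.yh j)| ≤ 1 * M * (G.hmax ^ 2 + G.kmax ^ 2) := by
      rw [abs_mul, abs_of_nonneg (by positivity), one_mul, mul_comm M]
      refine mul_le_mul ?_ (d.good.boundU 1 2 (by omega) _ (G.xh_mem hi.1 (by omega)) _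
        (yh_mem hj.1 (by omega))) (abs_nonneg _) hH
      linarith [pow_le_pow_left₀ hh.le (G.hh_le_hmax hi.1 (by omega)) 2, sq_nonneg G.kmax,
        sq_nonneg G.hmax]
    refine le_trans ?_ (scale 4 (G.hmax ^ 2 + G.kmax ^ 2) (by linarith) (by linarith) hH)
    have e : G.dxEx W i j - G.stressInterp U i j - G.dxEx (fun i j => W i j - G.interp U V i j) i j
        = (G.dxEx (G.interp U V) i j - U 1 0 (G.xh i) (G.yh j))
          - G.hh i ^ 2 / 8 * U 1 2 (G.xh i) (G.yh j) := by
      simp only [dxEx, stressInterp]; ring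
    rw [e]
    refine (abs_sub _ _).trans ((add_le_add a b).trans (le_of_eq ?_))
    ring
  · intro i hi j hj
    rw [mem_Icc] at hi hj
    have a := DyEx_interp_sub_le d.good (i := i) (by omega) (by omega) hj.1 hj.2
    have e : G.DyEx W i j - U 0 1 (G.xp i) (G.yp j)
          - G.DyEx (fun i j => W i j - G.interp U V i j) i j
        = G.DyEx (G.interp U V) i j - U 0 1 (G.xp i) (G.yp j) := by
      simp only [DyEx]; ring
    rw [e]
    exact a.trans (scale _ _ (by linarith) (by linarith) hH)
  · intro i hi j hj
    rw [mem_Icc] at hi hj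
    refine (abs_residual_le d hμ (by omega) (by omega) hj.1 (by omega)).trans ?_
    have s1 := scale (4 + G.Lx) (G.hmax ^ 2 + G.kmax ^ 2 + Δt) (by linarith) hD (by linarith)
    have s2 := mul_le_mul_of_nonneg_left
      (scale 1 (G.hmax ^ 2 + G.kmax ^ 2) (by linarith) (by linarith) hH) hμ
    have s3 := mul_nonneg (mul_nonneg (by linarith : 0 ≤ 3 + G.Lx) hM) hΔt.le
    linarith

/-- Energy inequality for the difference between the discrete velocity and the interpolant. -/
lemma velocity_step (d : StepData G.Lx G.Ly μ Δt M U V U' V' A B P gx gy) (hμ : 0 ≤ μ)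
    (hΔt : 0 < Δt) (hKx : 5 + 2 * G.Lx + 1 / G.Ly ≤ K) (hKy : 5 + 2 * G.Ly + 1 / G.Lx ≤ K)
    {Wx Wy Wx' Wy' Z : ℤ → ℤ → ℝ} (hxx : ∀ j, Wx 0 j = 0 ∧ Wx G.Nx j = 0)
    (hxy : ∀ i, Wx i (-1) = 0 ∧ Wx i G.Ny = 0) (hyy : ∀ i, Wy i 0 = 0 ∧ Wy i G.Ny = 0)
    (hyx : ∀ j, Wy (-1) j = 0 ∧ Wy G.Nx j = 0)
    (heqx : ∀ i ∈ Icc (1 : ℤ) ((G.Nx : ℤ) - 1), ∀ j ∈ Icc (0 : ℤ) ((G.Ny : ℤ) - 1),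
      (Wx i j - Wx' i j) / Δt
        - μ * ((G.dxEx Wx i j - G.dxEx Wx (i - 1) j) / G.hc i)
        - μ * ((G.DyEx Wx i (j + 1) - G.DyEx Wx i j) / G.kk j)
        + G.DxC Z i j = 1 / G.hc i * ∫ x in (G.xh (i - 1))..(G.xh i), gx x (G.yh j))
    (heqy : ∀ i ∈ Icc (0 : ℤ) ((G.Nx : ℤ) - 1), ∀ j ∈ Icc (1 : ℤ) ((G.Ny : ℤ) - 1),
      (Wy i j - Wy' i j) / Δt
        - μ * ((G.DxEy Wy (i + 1) j - G.DxEy Wy i j) / G.hh i)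
        - μ * ((G.dyEy Wy i j - G.dyEy Wy i (j - 1)) / G.kc j)
        + G.DyC Z i j = 1 / G.kc j * ∫ y in (G.yh (j - 1))..(G.yh j), gy (G.xh i) y)
    (hdiv : ∀ i ∈ Icc (0 : ℤ) ((G.Nx : ℤ) - 1), ∀ j ∈ Icc (0 : ℤ) ((G.Ny : ℤ) - 1),
      G.dxEx Wx i j + G.dyEy Wy i j = 0) :
    G.velNormSq (fun i j => Wx i j - G.interp U V i j)
        (fun i j => Wy i j - G.swap.interp (jswap V) (jswap U) j i)
      ≤ G.velNormSq (fun i j => Wx' i j - G.interp U' V' i j)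
          (fun i j => Wy' i j - G.swap.interp (jswap V') (jswap U') j i)
        + Δt * (G.velNormSq (fun i j => Wx i j - G.interp U V i j)
            (fun i j => Wy i j - G.swap.interp (jswap V) (jswap U) j i)
          + 2 * (G.Lx * G.Ly) * (K * M * (G.hmax ^ 2 + G.kmax ^ 2 + Δt)) ^ 2
            * ((1 + μ) ^ 2 + μ)) := by
  have sx := component_step d hμ hΔt hKx le_rfl hxx hxy heqx
  have sy := component_step (G := G.swap) (D := G.hmax ^ 2 + G.kmax ^ 2 + Δt)
    (W := fun j i => Wy i j) (W' := fun j i => Wy' i j) (Z := fun j i => Z i j) d.swap hμ hΔt hKy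
    (by show G.kmax ^ 2 + G.hmax ^ 2 + Δt ≤ _; linarith) hyy hyx (fun j hj i hi => by
      rw [sub_right_comm]
      exact heqy i hi j hj)
  have e1 := G.swap_ipTM (fun i j => Wy i j - G.swap.interp (jswap V) (jswap U) j i)
    (fun i j => Wy i j - G.swap.interp (jswap V) (jswap U) j i)
  have e2 := G.swap_ipTM (fun i j => Wy' i j - G.swap.interp (jswap V') (jswap U') j i)
    (fun i j => Wy' i j - G.swap.interp (jswap V') (jswap U') j i)
  have e3 := G.swap_ipM (fun i j => Z i j - G.swap.pressInterp (jswap B) (jswap A) (jswap P) j i)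
    (G.dyEy fun i j => Wy i j - G.swap.interp (jswap V) (jswap U) j i)
  rw [e1, e2] at sy
  change _ ≤ _ + 2 * Δt * G.swap.ipM _ (fun j i =>
    G.dyEy (fun i j => Wy i j - G.swap.interp (jswap V) (jswap U) j i) i j) + _ at sy
  rw [e3] at sy
  have e4 : G.ipM (fun i j => Z i j - G.pressInterp A B P i j)
        (G.dxEx fun i j => Wx i j - G.interp U V i j)
      + G.ipM (fun i j => Z i j - G.swap.pressInterp (jswap B) (jswap A) (jswap P) j i)
        (G.dyEy fun i j => Wy i j - G.swap.interp (jswap V) (jswap U) j i) = 0 := by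
    unfold ipM
    rw [← sum_add_distrib]
    refine sum_eq_zero fun i hi => ?_
    rw [← sum_add_distrib]
    refine sum_eq_zero fun j hj => ?_
    have w := hdiv i hi j hj
    rw [mem_Icc] at hi hj
    have v := div_interp d.good hi.1 (by omega) hj.1 (by omega)
    have q : G.swap.pressInterp (jswap B) (jswap A) (jswap P) j i = G.pressInterp A B P i j := by
      show P 0 0 (G.xh i) (G.yh j) + (G.kk j ^ 2 / 8 * B 0 1 (G.xh i) (G.yh j)
        + G.hh i ^ 2 / 8 * A 1 0 (G.xh i) (G.yh j)) = _
      rw [pressInterp]; ring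
    beta_reduce
    rw [q]
    have x : G.dxEx (fun i j => Wx i j - G.interp U V i j) i j
        + G.dyEy (fun i j => Wy i j - G.swap.interp (jswap V) (jswap U) j i) i j = 0 := by
      simp only [dxEx, dyEy] at w v ⊢
      linear_combination w - v
    linear_combination G.hh i * G.kk j * (Z i j - G.pressInterp A B P i j) * x
  have e5 : 2 * Δt * (G.ipM (fun i j => Z i j - G.pressInterp A B P i j)
        (G.dxEx fun i j => Wx i j - G.interp U V i j)
      + G.ipM (fun i j => Z i j - G.swap.pressInterp (jswap B) (jswap A) (jswap P) j i)
        (G.dyEy fun i j => Wy i j - G.swap.interp (jswap V) (jswap U) j i)) = 0 := by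
    rw [e4, mul_zero]
  change _ ≤ _ + _ + Δt * (_ + G.Ly * G.Lx * _ + μ * (G.Ly * G.Lx * _)) at sy
  unfold velNormSq
  nlinarith [sx, sy, e5]

/-- The interpolant is a second order approximation of the velocity in the discrete norm. -/
lemma velNormSq_interp_sub_le (hU : Jet U) (hV : Jet V) (bU : JetBound G.Lx G.Ly M U)
    (bV : JetBound G.Lx G.Ly M V) (hKx : 5 + 2 * G.Lx + 1 / G.Ly ≤ K)
    (hKy : 5 + 2 * G.Ly + 1 / G.Lx ≤ K) (hΔt : 0 ≤ Δt) :
    G.velNormSq (fun i j => G.interp U V i j - U 0 0 (G.xp i) (G.yh j))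
        (fun i j => G.swap.interp (jswap V) (jswap U) j i - V 0 0 (G.xh i) (G.yp j))
      ≤ 2 * (G.Lx * G.Ly) * (K * M * (G.hmax ^ 2 + G.kmax ^ 2 + Δt)) ^ 2 := by
  have comp : ∀ {G : Grid} {U V : ℕ → ℕ → ℝ → ℝ → ℝ} {D : ℝ}, Jet U → Jet V →
      JetBound G.Lx G.Ly M U → JetBound G.Lx G.Ly M V → 5 + 2 * G.Lx + 1 / G.Ly ≤ K →
      G.hmax ^ 2 + G.kmax ^ 2 ≤ D →
      G.ipTM (fun i j => G.interp U V i j - U 0 0 (G.xp i) (G.yh j))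
        (fun i j => G.interp U V i j - U 0 0 (G.xp i) (G.yh j))
        ≤ G.Lx * G.Ly * (K * M * D) ^ 2 := by
    intro G U V D hU hV bU bV hK hD
    have hM := nonneg_of_jetBound bU
    have hLx := G.Lx_pos
    have hLy := G.Ly_pos
    have hLy' : 0 < 1 / G.Ly := by positivity
    refine le_trans (le_of_eq ?_) (G.sum_edges_le
      (f := fun i j => (G.interp U V i j - U 0 0 (G.xp i) (G.yh j)) ^ 2) (sq_nonneg _) ?_)
    · unfold ipTM
      exact sum_congr rfl fun _ _ => sum_congr rfl fun _ _ => by ring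
    · intro i hi j hj
      rw [mem_Icc] at hi hj
      rw [← sq_abs]
      refine pow_le_pow_left₀ (abs_nonneg _) ((interp_sub_le hU hV bU bV (i := i) (by omega)
        (by omega) hj.1 (by omega)).trans ?_) 2
      have : (3 + G.Lx) * (M * (G.hmax ^ 2 + G.kmax ^ 2)) ≤ K * (M * D) :=
        mul_le_mul (by linarith) (mul_le_mul_of_nonneg_left hD hM) (by positivity) (by linarith)
      linarith
  have a := comp hU hV bU bV hKx (D := G.hmax ^ 2 + G.kmax ^ 2 + Δt) (by linarith)
  have b := comp (G := G.swap) (D := G.hmax ^ 2 + G.kmax ^ 2 + Δt) hV.swap hU.swap bV.swap bU.swap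
    hKy (by show G.kmax ^ 2 + G.hmax ^ 2 ≤ _; linarith)
  have e := G.swap_ipTM
    (fun i j => G.swap.interp (jswap V) (jswap U) j i - V 0 0 (G.xh i) (G.yp j))
    (fun i j => G.swap.interp (jswap V) (jswap U) j i - V 0 0 (G.xh i) (G.yp j))
  have b' : G.ipMT (fun i j => G.swap.interp (jswap V) (jswap U) j i - V 0 0 (G.xh i) (G.yp j))
      (fun i j => G.swap.interp (jswap V) (jswap U) j i - V 0 0 (G.xh i) (G.yp j))
      ≤ G.Ly * G.Lx * (K * M * (G.hmax ^ 2 + G.kmax ^ 2 + Δt)) ^ 2 := by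
    rw [← e]; exact b
  unfold velNormSq
  linarith

end Grid
end RMAC

namespace RMAC

/-! ### Partial derivatives of smooth functions -/

namespace Smooth

variable {f : ℝ → ℝ → ℝ → ℝ}

lemma differentiableAt (hf : Smooth f) (q : ℝ × ℝ × ℝ) :
    DifferentiableAt ℝ (fun q : ℝ × ℝ × ℝ => f q.1 q.2.1 q.2.2) q :=
  (hf 1).differentiable (by simp) q

lemma contDiff_fderiv (hf : Smooth f) (v : ℝ × ℝ × ℝ) (n : ℕ) :
    ContDiff ℝ n fun q => fderiv ℝ (fun q : ℝ × ℝ × ℝ => f q.1 q.2.1 q.2.2) q v :=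
  ((hf (n + 1)).fderiv_right (by norm_cast)).clm_apply contDiff_const

lemma hasDerivAt_fst (hf : Smooth f) (x y t : ℝ) : HasDerivAt (fun s => f s y t)
    (fderiv ℝ (fun q : ℝ × ℝ × ℝ => f q.1 q.2.1 q.2.2) (x, y, t) (1, 0, 0)) x := by
  have line : HasDerivAt (fun s : ℝ => (s, y, t)) ((1, 0, 0) : ℝ × ℝ × ℝ) x :=
    (hasDerivAt_id x).prodMk (hasDerivAt_const x (y, t))
  exact (hf.differentiableAt (x, y, t)).hasFDerivAt.comp_hasDerivAt x line

lemma hasDerivAt_snd (hf : Smooth f) (x y t : ℝ) : HasDerivAt (fun s => f x s t)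
    (fderiv ℝ (fun q : ℝ × ℝ × ℝ => f q.1 q.2.1 q.2.2) (x, y, t) (0, 1, 0)) y := by
  have line : HasDerivAt (fun s : ℝ => (x, s, t)) ((0, 1, 0) : ℝ × ℝ × ℝ) y :=
    (hasDerivAt_const y x).prodMk ((hasDerivAt_id y).prodMk (hasDerivAt_const y t))
  exact (hf.differentiableAt (x, y, t)).hasFDerivAt.comp_hasDerivAt y line

lemma hasDerivAt_thd (hf : Smooth f) (x y t : ℝ) : HasDerivAt (fun s => f x y s)
    (fderiv ℝ (fun q : ℝ × ℝ × ℝ => f q.1 q.2.1 q.2.2) (x, y, t) (0, 0, 1)) t := by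
  have line : HasDerivAt (fun s : ℝ => (x, y, s)) ((0, 0, 1) : ℝ × ℝ × ℝ) t :=
    (hasDerivAt_const t x).prodMk ((hasDerivAt_const t y).prodMk (hasDerivAt_id t))
  exact (hf.differentiableAt (x, y, t)).hasFDerivAt.comp_hasDerivAt t line

lemma pdx_eq (hf : Smooth f) : pdx f = fun x y t =>
    fderiv ℝ (fun q : ℝ × ℝ × ℝ => f q.1 q.2.1 q.2.2) (x, y, t) (1, 0, 0) := by
  funext x y t
  exact (hf.hasDerivAt_fst x y t).deriv

lemma pdy_eq (hf : Smooth f) : pdy f = fun x y t =>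
    fderiv ℝ (fun q : ℝ × ℝ × ℝ => f q.1 q.2.1 q.2.2) (x, y, t) (0, 1, 0) := by
  funext x y t
  exact (hf.hasDerivAt_snd x y t).deriv

lemma pdt_eq (hf : Smooth f) : pdt f = fun x y t =>
    fderiv ℝ (fun q : ℝ × ℝ × ℝ => f q.1 q.2.1 q.2.2) (x, y, t) (0, 0, 1) := by
  funext x y t
  exact (hf.hasDerivAt_thd x y t).deriv

lemma pdx (hf : Smooth f) : Smooth (pdx f) := by
  rw [hf.pdx_eq]
  exact hf.contDiff_fderiv (1, 0, 0)

lemma pdy (hf : Smooth f) : Smooth (pdy f) := by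
  rw [hf.pdy_eq]
  exact hf.contDiff_fderiv (0, 1, 0)

lemma pdt (hf : Smooth f) : Smooth (pdt f) := by
  rw [hf.pdt_eq]
  exact hf.contDiff_fderiv (0, 0, 1)

lemma fderiv_comm (hf : Smooth f) (v w q : ℝ × ℝ × ℝ) :
    fderiv ℝ (fun q => fderiv ℝ (fun q : ℝ × ℝ × ℝ => f q.1 q.2.1 q.2.2) q v) q w
      = fderiv ℝ (fun q => fderiv ℝ (fun q : ℝ × ℝ × ℝ => f q.1 q.2.1 q.2.2) q w) q v := by
  have hd : DifferentiableAt ℝ (fderiv ℝ fun q : ℝ × ℝ × ℝ => f q.1 q.2.1 q.2.2) q :=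
    ((hf 2).fderiv_right (m := 1) (by norm_num)).differentiable (by simp) q
  have key : ∀ v w : ℝ × ℝ × ℝ,
      fderiv ℝ (fun q => fderiv ℝ (fun q : ℝ × ℝ × ℝ => f q.1 q.2.1 q.2.2) q v) q w
        = fderiv ℝ (fderiv ℝ fun q : ℝ × ℝ × ℝ => f q.1 q.2.1 q.2.2) q w v := by
    intro v w
    rw [fderiv_clm_apply hd (differentiableAt_const v)]
    simp
  rw [key, key]
  exact (((hf 2).contDiffAt (x := q)).isSymmSndFDerivAt (by simp)).eq w v

lemma pdx_pdy (hf : Smooth f) : RMAC.pdx (RMAC.pdy f) = RMAC.pdy (RMAC.pdx f) := by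
  rw [hf.pdy.pdx_eq, hf.pdx.pdy_eq, hf.pdy_eq, hf.pdx_eq]
  funext x y t
  exact hf.fderiv_comm _ _ _

lemma pdt_pdx (hf : Smooth f) : RMAC.pdt (RMAC.pdx f) = RMAC.pdx (RMAC.pdt f) := by
  rw [hf.pdx.pdt_eq, hf.pdt.pdx_eq, hf.pdt_eq, hf.pdx_eq]
  funext x y t
  exact hf.fderiv_comm _ _ _

lemma pdt_pdy (hf : Smooth f) : RMAC.pdt (RMAC.pdy f) = RMAC.pdy (RMAC.pdt f) := by
  rw [hf.pdy.pdt_eq, hf.pdt.pdy_eq, hf.pdt_eq, hf.pdy_eq]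
  funext x y t
  exact hf.fderiv_comm _ _ _

lemma iterate {D : (ℝ → ℝ → ℝ → ℝ) → ℝ → ℝ → ℝ → ℝ} (hD : ∀ g, Smooth g → Smooth (D g))
    (hf : Smooth f) (n : ℕ) : Smooth (D^[n] f) := by
  induction n with
  | zero => exact hf
  | succ n ih => rw [Function.iterate_succ_apply']; exact hD _ ih

/-- An operator commutes with the iterates of another one as soon as both commute on smooth
functions. -/
lemma iterate_comm {D E : (ℝ → ℝ → ℝ → ℝ) → ℝ → ℝ → ℝ → ℝ} (hD : ∀ g, Smooth g → Smooth (D g))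
    (h : ∀ g, Smooth g → E (D g) = D (E g)) (hf : Smooth f) (n : ℕ) :
    E (D^[n] f) = D^[n] (E f) := by
  induction n with
  | zero => rfl
  | succ n ih =>
    rw [Function.iterate_succ_apply', Function.iterate_succ_apply', h _ (iterate hD hf n), ih]

end Smooth

/-- The spatial jet of `∂_t^a f` at time `t`. -/
def jet (f : ℝ → ℝ → ℝ → ℝ) (a : ℕ) (t : ℝ) : ℕ → ℕ → ℝ → ℝ → ℝ :=
  fun b c x y => (pdt^[a] (pdx^[b] (pdy^[c] f))) x y t

namespace Smooth

variable {f : ℝ → ℝ → ℝ → ℝ}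

lemma iterate_pdy (hf : Smooth f) (c : ℕ) : Smooth (RMAC.pdy^[c] f) := iterate (fun _ => pdy) hf c

lemma iterate_pdx (hf : Smooth f) (b c : ℕ) : Smooth (RMAC.pdx^[b] (RMAC.pdy^[c] f)) :=
  iterate (fun _ => pdx) (hf.iterate_pdy c) b

lemma iterate_pdt (hf : Smooth f) (a b c : ℕ) :
    Smooth (RMAC.pdt^[a] (RMAC.pdx^[b] (RMAC.pdy^[c] f))) :=
  iterate (fun _ => pdt) (hf.iterate_pdx b c) a

lemma jet (hf : Smooth f) (a : ℕ) (t : ℝ) : Jet (jet f a t) where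
  dx b c x y := by
    have h := (hf.iterate_pdt a b c).hasDerivAt_fst x y t
    have e : RMAC.pdt^[a] (RMAC.pdx^[b + 1] (RMAC.pdy^[c] f))
        = RMAC.pdx (RMAC.pdt^[a] (RMAC.pdx^[b] (RMAC.pdy^[c] f))) := by
      rw [Function.iterate_succ_apply', iterate_comm (fun _ => pdt) (fun _ hg => hg.pdt_pdx.symm)
        (hf.iterate_pdx b c)]
    rw [← h.deriv] at h
    unfold RMAC.jet
    rw [e]
    exact h
  dy b c x y := by
    have h := (hf.iterate_pdt a b c).hasDerivAt_snd x y t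
    have e : RMAC.pdt^[a] (RMAC.pdx^[b] (RMAC.pdy^[c + 1] f))
        = RMAC.pdy (RMAC.pdt^[a] (RMAC.pdx^[b] (RMAC.pdy^[c] f))) := by
      rw [Function.iterate_succ_apply', iterate_comm (fun _ => pdt) (fun _ hg => hg.pdt_pdy.symm)
        (hf.iterate_pdx b c), iterate_comm (fun _ => pdx) (fun _ hg => hg.pdx_pdy.symm)
        (hf.iterate_pdy c)]
    rw [← h.deriv] at h
    unfold RMAC.jet
    rw [e]
    exact h
  cont b c := (hf.iterate_pdt a b c 0).continuous.comp
    (by fun_prop : Continuous fun q : ℝ × ℝ => (q.1, q.2, t))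

lemma derivSeq_jet (hf : Smooth f) (b c : ℕ) (x y : ℝ) :
    DerivSeq fun a t => RMAC.jet f a t b c x y := by
  intro a t
  have h := (hf.iterate_pdt a b c).hasDerivAt_thd x y t
  rw [← h.deriv] at h
  have e : RMAC.jet f (a + 1) t b c x y
      = RMAC.pdt (RMAC.pdt^[a] (RMAC.pdx^[b] (RMAC.pdy^[c] f))) x y t := by
    rw [RMAC.jet, Function.iterate_succ_apply']
  beta_reduce
  rw [e]
  exact h

end Smooth

section

variable {μ Lx Ly T M t τ : ℝ} {f ux uy p gx gy : ℝ → ℝ → ℝ → ℝ}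

lemma SobBound.jetBound (h : SobBound 2 4 f Lx Ly T M) {a : ℕ} (ha : a ≤ 2)
    (ht : t ∈ Set.Icc 0 T) : JetBound Lx Ly M (jet f a t) :=
  fun b c hbc x hx y hy => h a b c ha hbc x y t hx hy ht

lemma SobBound.jquot (hf : Smooth f) (h : SobBound 2 4 f Lx Ly T M) (hτ : 0 < τ)
    (ht : t - τ ∈ Set.Icc 0 T) (ht' : t ∈ Set.Icc 0 T) :
    JetBound Lx Ly M (jquot (jet f 0 t) (jet f 0 (t - τ)) τ) := by
  intro b c hbc x hx y hy
  have := abs_sub_le_of_deriv_le (x := t - τ) (y := t) (B := M)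
    (fun z => hf.derivSeq_jet b c x y 0 z) fun z hz => by
      rw [Set.uIcc_of_le (by linarith)] at hz
      exact h.jetBound (by norm_num) ⟨ht.1.trans hz.1, hz.2.trans ht'.2⟩ b c hbc x hx y hy
  rw [sub_sub_cancel, abs_of_pos hτ] at this
  unfold RMAC.jquot
  rwa [abs_div, abs_of_pos hτ, div_le_iff₀ hτ]

lemma SobBound.abs_jquot_sub_le (hf : Smooth f) (h : SobBound 2 4 f Lx Ly T M) (hτ : 0 < τ)
    (ht : t - τ ∈ Set.Icc 0 T) (ht' : t ∈ Set.Icc 0 T) :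
    ∀ x ∈ Set.Icc 0 Lx, ∀ y ∈ Set.Icc 0 Ly,
      |RMAC.jquot (jet f 0 t) (jet f 0 (t - τ)) τ 0 0 x y - jet f 1 t 0 0 x y| ≤ M * τ := by
  intro x hx y hy
  have := (hf.derivSeq_jet 0 0 x y).slope_sub_right_le (a := t - τ) (b := t) (M := M)
    (by linarith) fun z hz =>
      h.jetBound le_rfl ⟨ht.1.trans hz.1, hz.2.trans ht'.2⟩ 0 0 (by norm_num) x hx y hy
  rwa [sub_sub_cancel] at this

lemma IsStokesSol.good (h : IsStokesSol μ Lx Ly T ux uy p gx gy) (hx : Smooth ux) (hy : Smooth uy)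
    (bx : SobBound 2 4 ux Lx Ly T M) (bY : SobBound 2 4 uy Lx Ly T M) (ht : t ∈ Set.Icc 0 T) :
    Good Lx Ly M (jet ux 0 t) (jet uy 0 t) := by
  have main : (∀ x ∈ Set.Ioo 0 Lx, ∀ y ∈ Set.Ioo 0 Ly, pdx ux x y t + pdy uy x y t = 0) ∧
      ∀ x ∈ Set.Icc 0 Lx, ∀ y ∈ Set.Icc 0 Ly,
        (x = 0 ∨ x = Lx ∨ y = 0 ∨ y = Ly) → ux x y t = 0 ∧ uy x y t = 0 := by
    rcases ht.1.eq_or_lt with rfl | h0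
    · refine ⟨fun x hx y hy => ?_, fun x hx y hy _ => h.2.2 x y hx hy⟩
      have e1 : (fun s => ux s y 0) =ᶠ[nhds x] fun _ => 0 := by
        filter_upwards [isOpen_Ioo.mem_nhds hx] with s hs
        exact (h.2.2 s y (Set.Ioo_subset_Icc_self hs) (Set.Ioo_subset_Icc_self hy)).1
      have e2 : (fun s => uy x s 0) =ᶠ[nhds y] fun _ => 0 := by
        filter_upwards [isOpen_Ioo.mem_nhds hy] with s hs
        exact (h.2.2 x s (Set.Ioo_subset_Icc_self hx) (Set.Ioo_subset_Icc_self hs)).2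
      simp [pdx, pdy, e1.deriv_eq, e2.deriv_eq]
    · exact ⟨fun x hx y hy => (h.1 x y t hx hy ⟨h0, ht.2⟩).2.2,
        fun x hx y hy => h.2.1 x y t hx hy ⟨h0, ht.2⟩⟩
  exact
    { jetU := hx.jet 0 t
      jetV := hy.jet 0 t
      boundU := bx.jetBound (by norm_num) ht
      boundV := bY.jetBound (by norm_num) ht
      div := main.1
      zeroU := fun x hx y hy hb => (main.2 x hx y hy hb).1
      zeroV := fun x hx y hy hb => (main.2 x hx y hy hb).2 }

lemma IsStokesSol.stepData (h : IsStokesSol μ Lx Ly T ux uy p gx gy) (hx : Smooth ux)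
    (hy : Smooth uy) (hp : Smooth p) (bx : SobBound 2 4 ux Lx Ly T M)
    (bY : SobBound 2 4 uy Lx Ly T M) (hτ : 0 < τ) (ht : t - τ ∈ Set.Icc 0 T)
    (ht' : t ∈ Set.Icc 0 T) :
    StepData Lx Ly μ τ M (jet ux 0 t) (jet uy 0 t) (jet ux 0 (t - τ)) (jet uy 0 (t - τ))
      (jet ux 1 t) (jet uy 1 t) (jet p 0 t) (fun x y => gx x y t) (fun x y => gy x y t) where
  good := h.good hx hy bx bY ht'
  good' := h.good hx hy bx bY ht
  quotU := bx.jquot hx hτ ht ht'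
  quotV := bY.jquot hy hτ ht ht'
  jetA := hx.jet 1 t
  jetB := hy.jet 1 t
  boundA := bx.jetBound (by norm_num) ht'
  boundB := bY.jetBound (by norm_num) ht'
  jetP := hp.jet 0 t
  timeU := bx.abs_jquot_sub_le hx hτ ht ht'
  timeV := bY.abs_jquot_sub_le hy hτ ht ht'
  momx x hx y hy := (h.1 x y t hx hy ⟨by linarith [ht.1], ht'.2⟩).1
  momy x hx y hy := (h.1 x y t hx hy ⟨by linarith [ht.1], ht'.2⟩).2.1

end

end RMAC

namespace RMAC
namespace Grid

variable {G : Grid}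

lemma velNormSq_le_add {vx vy ax ay bx bY : ℤ → ℤ → ℝ} {α β : ℝ}
    (hx : ∀ i ∈ Icc (1 : ℤ) ((G.Nx : ℤ) - 1), ∀ j ∈ Icc (0 : ℤ) ((G.Ny : ℤ) - 1),
      vx i j ^ 2 ≤ α * ax i j ^ 2 + β * bx i j ^ 2)
    (hy : ∀ i ∈ Icc (0 : ℤ) ((G.Nx : ℤ) - 1), ∀ j ∈ Icc (1 : ℤ) ((G.Ny : ℤ) - 1),
      vy i j ^ 2 ≤ α * ay i j ^ 2 + β * bY i j ^ 2) :
    G.velNormSq vx vy ≤ α * G.velNormSq ax ay + β * G.velNormSq bx bY := by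
  have ex : G.ipTM vx vx ≤ α * G.ipTM ax ax + β * G.ipTM bx bx := by
    simp only [ipTM, mul_sum, ← sum_add_distrib]
    refine sum_le_sum fun i hi => sum_le_sum fun j hj => ?_
    have h := hx i hi j hj
    rw [mem_Icc] at hi hj
    have w := mul_le_mul_of_nonneg_left h (mul_pos (G.hc_pos (i := i) (by omega) (by omega))
      (G.kk_pos hj.1 (by omega))).le
    linarith
  have ey : G.ipMT vy vy ≤ α * G.ipMT ay ay + β * G.ipMT bY bY := by
    simp only [ipMT, mul_sum, ← sum_add_distrib]
    refine sum_le_sum fun i hi => sum_le_sum fun j hj => ?_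
    have h := hy i hi j hj
    rw [mem_Icc] at hi hj
    have w := mul_le_mul_of_nonneg_left h (mul_pos (G.hh_pos hi.1 (by omega))
      (G.kc_pos (j := j) (by omega) (by omega))).le
    linarith
  unfold velNormSq
  linarith

lemma velNormSq_nonneg (vx vy : ℤ → ℤ → ℝ) : 0 ≤ G.velNormSq vx vy := by
  have := velNormSq_le_add (G := G) (vx := 0) (vy := 0) (ax := vx) (ay := vy) (bx := 0) (bY := 0)
    (α := 1) (β := 0) (fun i _ j _ => by simpa using sq_nonneg _)
    (fun i _ j _ => by simpa using sq_nonneg _)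
  simpa [velNormSq, ipTM, ipMT] using this

variable (G) in
lemma velNormSq_le_of_sq_le {vx vy ax ay : ℤ → ℤ → ℝ}
    (hx : ∀ i ∈ Icc (1 : ℤ) ((G.Nx : ℤ) - 1), ∀ j ∈ Icc (0 : ℤ) ((G.Ny : ℤ) - 1),
      vx i j ^ 2 ≤ ax i j ^ 2)
    (hy : ∀ i ∈ Icc (0 : ℤ) ((G.Nx : ℤ) - 1), ∀ j ∈ Icc (1 : ℤ) ((G.Ny : ℤ) - 1),
      vy i j ^ 2 ≤ ay i j ^ 2) : G.velNormSq vx vy ≤ G.velNormSq ax ay := by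
  have := velNormSq_le_add (G := G) (vx := vx) (vy := vy) (ax := ax) (ay := ay) (bx := 0) (bY := 0)
    (α := 1) (β := 0) (fun i hi j hj => by simpa using hx i hi j hj)
    (fun i hi j hj => by simpa using hy i hi j hj)
  rwa [one_mul, zero_mul, add_zero] at this

variable (G) in
lemma velNormSq_sub_le (vx vy wx wy zx zy : ℤ → ℤ → ℝ) :
    G.velNormSq (fun i j => vx i j - zx i j) (fun i j => vy i j - zy i j)
      ≤ 2 * G.velNormSq (fun i j => vx i j - wx i j) (fun i j => vy i j - wy i j)
        + 2 * G.velNormSq (fun i j => wx i j - zx i j) (fun i j => wy i j - zy i j) :=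
  velNormSq_le_add (fun i _ j _ => by nlinarith [sq_nonneg (vx i j - 2 * wx i j + zx i j)])
    (fun i _ j _ => by nlinarith [sq_nonneg (vy i j - 2 * wy i j + zy i j)])

/-- Bound of the discrete velocity error in terms of the mesh sizes. -/
lemma velNormSq_error_le {K M T μ Δt : ℝ} {N : ℕ} {ux uy p gx gy : ℝ → ℝ → ℝ → ℝ}
    {Wx Wy Z : ℕ → ℤ → ℤ → ℝ} (hμ : 0 ≤ μ) (hΔt : 0 < Δt) (hΔt' : Δt ≤ 1 / 2) (hN : N * Δt = T)
    (hKx : 5 + 2 * G.Lx + 1 / G.Ly ≤ K) (hKy : 5 + 2 * G.Ly + 1 / G.Lx ≤ K)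
    (hx : Smooth ux) (hy : Smooth uy) (hp : Smooth p)
    (h : IsStokesSol μ G.Lx G.Ly T ux uy p gx gy)
    (bx : SobBound 2 4 ux G.Lx G.Ly T M) (bY : SobBound 2 4 uy G.Lx G.Ly T M)
    (hW : G.IsRMAC μ Δt (G.avgFx gx Δt) (G.avgFy gy Δt) Wx Wy Z) {m : ℕ} (hm : m ≤ N) :
    G.velNormSq (fun i j => Wx m i j - ux (G.xp i) (G.yh j) (m * Δt))
        (fun i j => Wy m i j - uy (G.xh i) (G.yp j) (m * Δt))
      ≤ 2 * (Real.exp (2 * T) * (1 + 2 * T * ((1 + μ) ^ 2 + μ)) + 1)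
        * (2 * (G.Lx * G.Ly) * (K * M * (G.hmax ^ 2 + G.kmax ^ 2 + Δt)) ^ 2) := by
  obtain ⟨hxx, hxy, hyy, hyx, hinit, heqx, heqy, hdiv⟩ := hW
  set S := 2 * (G.Lx * G.Ly) * (K * M * (G.hmax ^ 2 + G.kmax ^ 2 + Δt)) ^ 2 with hS
  have hLx := G.Lx_pos
  have hLy := G.Ly_pos
  have hS0 : 0 ≤ S := by positivity
  have time : ∀ n : ℕ, n ≤ N → (n : ℝ) * Δt ∈ Set.Icc 0 T := fun n hn => by
    have : (n : ℝ) ≤ N := by exact_mod_cast hn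
    exact ⟨by positivity, hN ▸ mul_le_mul_of_nonneg_right this hΔt.le⟩
  have hT : 0 ≤ T := (time m hm).1.trans (time m hm).2
  have approx : ∀ n : ℕ, n ≤ N → G.velNormSq
      (fun i j => G.interp (jet ux 0 (n * Δt)) (jet uy 0 (n * Δt)) i j
        - ux (G.xp i) (G.yh j) (n * Δt))
      (fun i j => G.swap.interp (jswap (jet uy 0 (n * Δt))) (jswap (jet ux 0 (n * Δt))) j i
        - uy (G.xh i) (G.yp j) (n * Δt)) ≤ S := fun n hn =>
    velNormSq_interp_sub_le (hx.jet 0 _) (hy.jet 0 _) (bx.jetBound (by norm_num) (time n hn))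
      (bY.jetBound (by norm_num) (time n hn)) hKx hKy hΔt.le
  let a : ℕ → ℝ := fun n => G.velNormSq
      (fun i j => Wx n i j - G.interp (jet ux 0 (n * Δt)) (jet uy 0 (n * Δt)) i j)
      (fun i j => Wy n i j
        - G.swap.interp (jswap (jet uy 0 (n * Δt))) (jswap (jet ux 0 (n * Δt))) j i)
  have a0 : a 0 ≤ S := by
    refine le_trans ?_ (approx 0 (Nat.zero_le _))
    refine G.velNormSq_le_of_sq_le (fun i hi j hj => ?_) fun i hi j hj => ?_
    · rw [mem_Icc] at hi hj
      have e : ux (G.xp i) (G.yh j) ((0 : ℕ) * Δt) = 0 := by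
        rw [Nat.cast_zero, zero_mul]
        exact (h.2.2 _ _ (G.xp_mem (by omega) (by omega)) (G.yh_mem hj.1 (by omega))).1
      rw [(hinit i j).1, e, zero_sub, neg_sq, sub_zero]
    · rw [mem_Icc] at hi hj
      have e : uy (G.xh i) (G.yp j) ((0 : ℕ) * Δt) = 0 := by
        rw [Nat.cast_zero, zero_mul]
        exact (h.2.2 _ _ (G.xh_mem hi.1 (by omega)) (G.yp_mem (by omega) (by omega))).2
      rw [(hinit i j).2, e, zero_sub, neg_sq, sub_zero]
  have step : ∀ n, n + 1 ≤ N → a (n + 1) ≤ a n + Δt * (a (n + 1) + S * ((1 + μ) ^ 2 + μ)) := by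
    intro n hn
    have e : ((n + 1 : ℕ) : ℝ) * Δt - Δt = n * Δt := by push_cast; ring
    have d := h.stepData (M := M) hx hy hp bx bY hΔt (by rw [e]; exact time n (by omega))
      (time (n + 1) hn)
    rw [e] at d
    exact velocity_step d hμ hΔt hKx hKy (hxx (n + 1)) (hxy (n + 1)) (hyy (n + 1)) (hyx (n + 1))
      (heqx (n + 1) (by omega)) (heqy (n + 1) (by omega)) (hdiv (n + 1) (by omega))
  have an : ∀ n, 0 ≤ a n := fun n => velNormSq_nonneg _ _
  have hΓ : 0 ≤ (1 + μ) ^ 2 + μ := by positivity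
  have am := implicit_gronwall hΔt hΔt' (mul_nonneg hS0 hΓ) an step m hm
  have am' : a m ≤ Real.exp (2 * T) * (S + 2 * T * (S * ((1 + μ) ^ 2 + μ))) := by
    refine am.trans ?_
    have ht := (time m hm).2
    have ht0 := (time m hm).1
    have hSΓ := mul_nonneg hS0 hΓ
    have a0n := an 0
    have : 0 ≤ a 0 + 2 * (m * Δt) * (S * ((1 + μ) ^ 2 + μ)) := by positivity
    gcongr
  have tri : _ ≤ 2 * a m + _ := G.velNormSq_sub_le (Wx m) (Wy m)
    (G.interp (jet ux 0 (m * Δt)) (jet uy 0 (m * Δt)))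
    (fun i j => G.swap.interp (jswap (jet uy 0 (m * Δt))) (jswap (jet ux 0 (m * Δt))) j i)
    (fun i j => ux (G.xp i) (G.yh j) (m * Δt)) (fun i j => uy (G.xh i) (G.yp j) (m * Δt))
  have := approx m hm
  linarith

end Grid
end RMAC

open RMAC

/-- pressure-robust and μ-robust second-order velocity superconvergence of
the RMAC scheme on non-uniform grids. For `Δt` sufficiently small,
`‖W^m − u^m‖_{l²} ≤ C e^{μT/2}(1+μ+μ²+μ³)^{1/2} (h²+k²+Δt)` for all `1 ≤ m ≤ N`, where `C`
depends only on `T`, `Ω`, the mesh-regularity constant `C₀` and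
`‖u‖_{W^{2,∞}([0,T];W^{4,∞}(Ω))}`; in particular `C` is independent of `h`, `k`, `Δt`, of the
pressure `p`, and of `μ`. -/
theorem rmac_velocity_superconvergence (Lx Ly T C₀ Mu : ℝ)
    (hLx : 0 < Lx) (hLy : 0 < Ly) (hT : 0 < T) (hC₀ : 0 < C₀) (hMu : 0 ≤ Mu) :
    ∃ C : ℝ, 0 < C ∧ ∃ δ : ℝ, 0 < δ ∧
      ∀ μ : ℝ, 0 < μ →
      ∀ G : RMAC.Grid, G.Lx = Lx → G.Ly = Ly → G.Regular C₀ →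
      ∀ N : ℕ, 1 ≤ N → ∀ Δt : ℝ, Δt = T / N → Δt ≤ δ →
      ∀ ux uy p gx gy : ℝ → ℝ → ℝ → ℝ,
        RMAC.Smooth ux → RMAC.Smooth uy → RMAC.Smooth p →
        RMAC.IsStokesSol μ Lx Ly T ux uy p gx gy →
        RMAC.SobBound 2 4 ux Lx Ly T Mu → RMAC.SobBound 2 4 uy Lx Ly T Mu →
      ∀ Wx Wy Z : ℕ → ℤ → ℤ → ℝ,
        G.IsRMAC μ Δt (G.avgFx gx Δt) (G.avgFy gy Δt) Wx Wy Z →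
      ∀ m : ℕ, 1 ≤ m → m ≤ N →
        Real.sqrt (G.velNormSq
            (fun i j => Wx m i j - ux (G.xp i) (G.yh j) ((m : ℝ) * Δt))
            (fun i j => Wy m i j - uy (G.xh i) (G.yp j) ((m : ℝ) * Δt))) ≤
          C * Real.exp (μ * T / 2) * Real.sqrt (1 + μ + μ ^ 2 + μ ^ 3) *
            (G.hmax ^ 2 + G.kmax ^ 2 + Δt) := by
  set K := 5 + 2 * Lx + 2 * Ly + 1 / Lx + 1 / Ly with hK
  obtain ⟨E, hE⟩ : ∃ E, E = 2 * (Real.exp (2 * T) * (1 + 6 * T) + 1)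
    * (2 * (Lx * Ly) * (K * Mu) ^ 2) := ⟨_, rfl⟩
  have hE0 : 0 ≤ E := by rw [hE]; positivity
  refine ⟨Real.sqrt E + 1, by positivity, 1 / 2, by norm_num, ?_⟩
  intro μ hμ G hGx hGy _ N hN Δt hΔt hδ ux uy p gx gy hx hy hp hsol bx bY Wx Wy Z hW m _ hm
  subst hGx hGy
  have hN0 : (0 : ℝ) < N := by exact_mod_cast hN
  have hΔt0 : 0 < Δt := by rw [hΔt]; positivity
  have hx' : 0 < 1 / G.Lx := by positivity
  have hy' : 0 < 1 / G.Ly := by positivity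
  have err := Grid.velNormSq_error_le (K := K) hμ.le hΔt0 hδ (by rw [hΔt]; field_simp)
    (by linarith) (by linarith) hx hy hp hsol bx bY hW hm
  set D := G.hmax ^ 2 + G.kmax ^ 2 + Δt with hD
  set Q := 1 + μ + μ ^ 2 + μ ^ 3 with hQ
  have hQ1 : 1 ≤ Q := by
    have : 0 ≤ μ + μ ^ 2 + μ ^ 3 := by positivity
    linarith
  have hD0 : 0 ≤ D := by positivity
  have factor : Real.exp (2 * T) * (1 + 2 * T * ((1 + μ) ^ 2 + μ)) + 1
      ≤ (Real.exp (2 * T) * (1 + 6 * T) + 1) * Q := by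
    have h3 : (1 + μ) ^ 2 + μ ≤ 3 * Q := by
      have : 0 ≤ 2 + 2 * μ ^ 2 + 3 * μ ^ 3 := by positivity
      rw [hQ]; linarith
    have h4 : 1 + 2 * T * ((1 + μ) ^ 2 + μ) ≤ (1 + 6 * T) * Q := by
      have := mul_le_mul_of_nonneg_left h3 hT.le
      linarith
    have := mul_le_mul_of_nonneg_left h4 (Real.exp_pos (2 * T)).le
    linarith
  have hbound : E * Q * D ^ 2 ≤ ((Real.sqrt E + 1) * Real.sqrt Q * D) ^ 2 := by
    rw [mul_pow, mul_pow, Real.sq_sqrt (by linarith)]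
    have : E ≤ (Real.sqrt E + 1) ^ 2 := by
      rw [add_sq, Real.sq_sqrt hE0]
      linarith [Real.sqrt_nonneg E]
    gcongr
  calc _ ≤ (Real.sqrt E + 1) * Real.sqrt Q * D := by
        refine Real.sqrt_le_iff.mpr ⟨by positivity, err.trans (le_trans ?_ hbound)⟩
        have := mul_le_mul_of_nonneg_right factor
          (by positivity : 0 ≤ 2 * (2 * (G.Lx * G.Ly) * (K * Mu * D) ^ 2))
        rw [hE]
        linarith
    _ = (Real.sqrt E + 1) * 1 * Real.sqrt Q * D := by ring
    _ ≤ _ := by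
        have : 1 ≤ Real.exp (μ * T / 2) := Real.one_le_exp (by positivity)
        gcongr
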